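/- arXiv:1609.06675 — 3 statements merged into one kernel-verified Lean document; each statement's English description precedes it below -/
import Mathlib

section
/- Let p ≥ 2, f ∈ ℝⁿ, ξ ∼ N(0, σ²I_{n×n}), y = f + ξ. Assume the diagonal elements of (1/n)𝕏ᵀ𝕏 are at most 1, and let λ ≥ 2σ√(2 log(p)/n). Let β̂ be any solution of the LASSO problem min_{β∈ℝᵖ}( ‖y − 𝕏β‖² + 2λ|β|₁ ). Then E‖𝕏β̂ − f‖ ≤ min over S ⊆ {1,…,p} of [ min_{β: supp(β)=S} ‖𝕏β − f‖ + 3λ√|S|/(2κ(S,3)) ] + σ/√(2πn), with the convention a/0 = +∞ for a > 0. -/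
open MeasureTheory ProbabilityTheory
open scoped ENNReal

/-- The scaled Euclidean norm `‖u‖ = sqrt((1/n) ∑ u_i²)` on `ℝⁿ`. -/
noncomputable def scaledNorm {n : ℕ} (u : Fin n → ℝ) : ℝ :=
  Real.sqrt ((∑ i, u i ^ 2) / n)

/-- The Gaussian measure `N(0, σ²I_{n×n})` on `ℝⁿ` (i.i.d. `N(0,σ²)` components). -/
noncomputable def gaussianVec (n : ℕ) (σ : ℝ) : Measure (Fin n → ℝ) :=
  Measure.pi fun _ : Fin n => gaussianReal 0 ⟨σ ^ 2, sq_nonneg σ⟩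

/-- The squared Restricted Eigenvalue constant
`κ²(S,c₀) = min { ‖XΔ‖²/|Δ|₂² : Δ ≠ 0, |Δ_{Sᶜ}|₁ ≤ c₀ |Δ_S|₁ }`. -/
noncomputable def kappaSq {n p : ℕ} (X : Matrix (Fin n) (Fin p) ℝ)
    (S : Finset (Fin p)) (c₀ : ℝ) : ℝ :=
  sInf {r | ∃ Δ : Fin p → ℝ, Δ ≠ 0 ∧ (∑ j ∈ Sᶜ, |Δ j|) ≤ c₀ * ∑ j ∈ S, |Δ j| ∧
    r = scaledNorm (X.mulVec Δ) ^ 2 / ∑ j, Δ j ^ 2}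

open Filter Topology Set in
/-- An upper bound on an improper integral through a primitive of a majorant. -/
lemma setLIntegral_Ioi_le_of_hasDerivAt {u g g' : ℝ → ℝ} {a : ℝ}
    (hderiv : ∀ x ∈ Ici a, HasDerivAt g (g' x) x) (hneg : ∀ x ∈ Ioi a, g' x ≤ 0)
    (hg : Tendsto g atTop (𝓝 0)) (hu : ∀ x ∈ Ioi a, u x ≤ -g' x) :
    ∫⁻ x in Ioi a, ENNReal.ofReal (u x) ≤ ENNReal.ofReal (g a) := by
  have hInt := integrableOn_Ioi_deriv_of_nonpos' hderiv hneg hg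
  calc ∫⁻ x in Ioi a, ENNReal.ofReal (u x)
      ≤ ∫⁻ x in Ioi a, ENNReal.ofReal (-g' x) :=
        setLIntegral_mono' measurableSet_Ioi fun x hx => ENNReal.ofReal_le_ofReal (hu x hx)
    _ = ENNReal.ofReal (∫ x in Ioi a, -g' x) := by
        refine (ofReal_integral_eq_lintegral_ofReal hInt.neg ?_).symm
        exact (ae_restrict_iff' measurableSet_Ioi).2
          (Eventually.of_forall fun x hx => by simpa using hneg x hx)
    _ = ENNReal.ofReal (g a) := by
        rw [integral_neg, integral_Ioi_of_hasDerivAt_of_nonpos' hderiv hneg hg]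
        simp

lemma gaussianPDFReal_zero_one (x : ℝ) :
    gaussianPDFReal 0 1 x = (√(2 * Real.pi))⁻¹ * Real.exp (-x ^ 2 / 2) := by
  simp [gaussianPDFReal]

lemma hasDerivAt_gaussianPDFReal (x : ℝ) :
    HasDerivAt (gaussianPDFReal 0 1) (-x * gaussianPDFReal 0 1 x) x := by
  have h1 : HasDerivAt (fun x : ℝ => -x ^ 2 / 2) (-x) x := by
    have := ((hasDerivAt_pow 2 x).neg).div_const 2
    convert! this using 1
    simp only [Nat.add_one_sub_one, pow_one, Nat.cast_ofNat]
    ring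
  have h2 := (h1.exp).const_mul (√(2 * Real.pi))⁻¹
  have h3 : gaussianPDFReal 0 1 = fun x => (√(2 * Real.pi))⁻¹ * Real.exp (-x ^ 2 / 2) :=
    funext gaussianPDFReal_zero_one
  rw [h3]
  convert! h2 using 1
  ring

open Filter Topology in
lemma tendsto_gaussianPDFReal_atTop : Tendsto (gaussianPDFReal 0 1) atTop (𝓝 0) := by
  have h3 : gaussianPDFReal 0 1 = fun x => (√(2 * Real.pi))⁻¹ * Real.exp (-x ^ 2 / 2) :=
    funext gaussianPDFReal_zero_one
  rw [h3, ← mul_zero (√(2 * Real.pi))⁻¹]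
  refine Tendsto.const_mul _ (Real.tendsto_exp_atBot.comp ?_)
  have := (tendsto_pow_atTop (α := ℝ) two_ne_zero).atTop_div_const (r := 2) (by norm_num)
  convert tendsto_neg_atTop_atBot.comp this using 1
  funext x
  simp only [Function.comp_apply]
  ring

open Set in
/-- The mean of the positive part of a standard Gaussian variable. -/
lemma lintegral_ofReal_gaussianReal_le :
    ∫⁻ x, ENNReal.ofReal x ∂(gaussianReal 0 1) ≤ ENNReal.ofReal (1 / √(2 * Real.pi)) := by
  rw [gaussianReal_of_var_ne_zero 0 one_ne_zero,
    lintegral_withDensity_eq_lintegral_mul _ (measurable_gaussianPDF 0 1) (by fun_prop)]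
  have h : ∀ x : ℝ, (gaussianPDF 0 1 * fun x => ENNReal.ofReal x) x
      = (Ioi (0 : ℝ)).indicator (fun x => ENNReal.ofReal (x * gaussianPDFReal 0 1 x)) x := by
    intro x
    by_cases hx : 0 < x
    · simp [hx, gaussianPDF, ENNReal.ofReal_mul hx.le, mul_comm]
    · simp [hx, ENNReal.ofReal_of_nonpos (not_lt.1 hx)]
  rw [lintegral_congr h, lintegral_indicator measurableSet_Ioi]
  have := setLIntegral_Ioi_le_of_hasDerivAt (u := fun x => x * gaussianPDFReal 0 1 x) (a := 0)
    (fun x _ => hasDerivAt_gaussianPDFReal x)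
    (fun x hx => by nlinarith [mul_nonneg (mem_Ioi.1 hx).le (gaussianPDFReal_nonneg 0 1 x)])
    tendsto_gaussianPDFReal_atTop (fun x _ => by simp)
  refine this.trans (le_of_eq ?_)
  simp [gaussianPDFReal_zero_one]

open Set Filter Topology in
/-- The third convergent of the continued fraction bounds the Gaussian tail from above. -/
lemma gaussianReal_Ioi_le {t : ℝ} (ht : 0 < t) :
    gaussianReal 0 1 (Ioi t)
      ≤ ENNReal.ofReal (gaussianPDFReal 0 1 t * ((t ^ 2 + 2) / (t ^ 3 + 3 * t))) := by
  rw [gaussianReal_apply 0 one_ne_zero]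
  have hD : ∀ x : ℝ, 0 < x → HasDerivAt (fun x : ℝ => (x ^ 2 + 2) / (x ^ 3 + 3 * x))
      ((2 * x * (x ^ 3 + 3 * x) - (x ^ 2 + 2) * (3 * x ^ 2 + 3)) / (x ^ 3 + 3 * x) ^ 2) x := by
    intro x hx
    have h1 : HasDerivAt (fun x : ℝ => x ^ 2 + 2) (2 * x) x := by
      simpa using (hasDerivAt_pow 2 x).add_const 2
    have h2 : HasDerivAt (fun x : ℝ => x ^ 3 + 3 * x) (3 * x ^ 2 + 3) x := by
      convert! (hasDerivAt_pow 3 x).add ((hasDerivAt_id x).const_mul 3) using 1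
      simp
    exact h1.div h2 (by positivity)
  have key : ∀ x : ℝ, 0 < x →
      (-x * gaussianPDFReal 0 1 x) * ((x ^ 2 + 2) / (x ^ 3 + 3 * x))
        + gaussianPDFReal 0 1 x *
          ((2 * x * (x ^ 3 + 3 * x) - (x ^ 2 + 2) * (3 * x ^ 2 + 3)) / (x ^ 3 + 3 * x) ^ 2)
      = - gaussianPDFReal 0 1 x * (1 + 6 / (x ^ 3 + 3 * x) ^ 2) := by
    intro x hx
    have : x ^ 3 + 3 * x ≠ 0 := by positivity
    field_simp
    ring
  refine setLIntegral_Ioi_le_of_hasDerivAt (a := t) (u := gaussianPDFReal 0 1)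
    (g := fun x => gaussianPDFReal 0 1 x * ((x ^ 2 + 2) / (x ^ 3 + 3 * x)))
    (g' := fun x => - gaussianPDFReal 0 1 x * (1 + 6 / (x ^ 3 + 3 * x) ^ 2)) ?_ ?_ ?_ ?_
  · intro x hx
    have hx0 : 0 < x := ht.trans_le hx
    rw [← key x hx0]
    exact (hasDerivAt_gaussianPDFReal x).mul (hD x hx0)
  · intro x hx
    have := gaussianPDFReal_nonneg 0 1 x
    have h6 : (0 : ℝ) ≤ 1 + 6 / (x ^ 3 + 3 * x) ^ 2 := by positivity
    nlinarith
  · have hb : ∀ᶠ x in atTop, ‖(fun x : ℝ => (x ^ 2 + 2) / (x ^ 3 + 3 * x)) x‖ ≤ 1 := by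
      filter_upwards [eventually_ge_atTop (1 : ℝ)] with x hx
      have hx0 : 0 < x := by linarith
      have h0 : 0 < x ^ 3 + 3 * x := by positivity
      rw [Real.norm_of_nonneg (by positivity), div_le_one h0]
      nlinarith [mul_nonneg (sq_nonneg x) (sub_nonneg.2 hx)]
    simpa using tendsto_gaussianPDFReal_atTop.zero_mul_isBoundedUnder_le
      (isBoundedUnder_of_eventually_le hb)
  · intro x hx
    have := gaussianPDFReal_nonneg 0 1 x
    have h6 : (0 : ℝ) ≤ 6 / (x ^ 3 + 3 * x) ^ 2 := by positivity
    nlinarith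

lemma ENNReal.ofReal_finsetSum_le {ι : Type*} (s : Finset ι) (u : ι → ℝ) :
    ENNReal.ofReal (∑ i ∈ s, u i) ≤ ∑ i ∈ s, ENNReal.ofReal (u i) :=
  Finset.le_sum_of_subadditive _ ENNReal.ofReal_zero.le (fun _ _ => ENNReal.ofReal_add_le) s u

section ConvexDistance

variable {E : Type*} [NormedAddCommGroup E] [InnerProductSpace ℝ E] [FiniteDimensional ℝ E]

open Metric in
/-- The distance to a closed convex set has a unit subgradient at every outside point. -/
lemma exists_subgradient_infDist {A : Set E} (hA : IsClosed A) (hne : A.Nonempty)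
    (hconv : Convex ℝ A) {x : E} (hx : x ∉ A) :
    ∃ v : E, ‖v‖ = 1 ∧ ∀ y, infDist x A - infDist y A ≤ inner ℝ v (x - y) := by
  have : ProperSpace E := FiniteDimensional.proper ℝ E
  obtain ⟨a, haA, ha⟩ := exists_norm_eq_iInf_of_complete_convex hne hA.isComplete hconv x
  have hin := (norm_eq_iInf_iff_real_inner_le_zero hconv haA).1 ha
  have hpos : 0 < ‖x - a‖ := norm_pos_iff.2 (sub_ne_zero.2 fun h => hx (h ▸ haA))
  refine ⟨‖x - a‖⁻¹ • (x - a), by simp [norm_smul, hpos.ne'], fun y => ?_⟩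
  obtain ⟨b, hbA, hb⟩ := hA.exists_infDist_eq_dist hne y
  have h1 : infDist x A ≤ ‖x - a‖ := by simpa [dist_eq_norm] using infDist_le_dist_of_mem haA
  have h2 : ‖x - a‖⁻¹ * inner ℝ (x - a) (y - b) ≤ ‖y - b‖ := by
    rw [inv_mul_le_iff₀ hpos]
    exact real_inner_le_norm _ _
  have h3 : inner ℝ (x - a) (x - y) =
      ‖x - a‖ ^ 2 - inner ℝ (x - a) (y - b) - inner ℝ (x - a) (b - a) := by
    rw [← real_inner_self_eq_norm_sq, ← inner_sub_right, ← inner_sub_right]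
    congr 1
    abel
  have h4 := mul_nonpos_of_nonneg_of_nonpos (inv_nonneg.2 hpos.le) (hin b hbA)
  have h5 : ‖x - a‖⁻¹ * ‖x - a‖ ^ 2 = ‖x - a‖ := by field_simp
  rw [real_inner_smul_left, h3, mul_sub, mul_sub, h5, hb, dist_eq_norm]
  linarith

lemma le_add_infDist_of_forall_mem {Φ : E → ℝ} (hΦ : ∀ x a, Φ x ≤ Φ a + ‖x - a‖) {A : Set E}
    (hA : IsClosed A) (hne : A.Nonempty) {m : ℝ} (hm : ∀ a ∈ A, Φ a ≤ m) (x : E) :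
    Φ x ≤ m + Metric.infDist x A := by
  have : ProperSpace E := FiniteDimensional.proper ℝ E
  obtain ⟨a, ha, h⟩ := hA.exists_infDist_eq_dist hne x
  rw [h, dist_eq_norm]
  linarith [hΦ x a, hm a ha]

end ConvexDistance

section StdGaussian

variable {E : Type*} [NormedAddCommGroup E] [InnerProductSpace ℝ E] [FiniteDimensional ℝ E]
  [MeasurableSpace E] [BorelSpace E]

lemma map_inner_stdGaussian (v : E) :
    (stdGaussian E).map (fun x => inner ℝ v x) = gaussianReal 0 (‖v‖ ^ 2).toNNReal := by
  have h := IsGaussian.map_eq_gaussianReal (μ := stdGaussian E) (innerSL ℝ v)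
  rw [integral_strongDual_stdGaussian, variance_dual_stdGaussian, innerSL_apply_norm] at h
  exact h

lemma lintegral_ofReal_inner_stdGaussian_le {v : E} (hv : ‖v‖ = 1) :
    ∫⁻ x, ENNReal.ofReal (inner ℝ v x) ∂(stdGaussian E)
      ≤ ENNReal.ofReal (1 / √(2 * Real.pi)) := by
  have h := map_inner_stdGaussian v
  rw [hv, one_pow, Real.toNNReal_one] at h
  rw [← lintegral_map (f := fun t : ℝ => ENNReal.ofReal t) (by fun_prop) (by fun_prop), h]
  exact lintegral_ofReal_gaussianReal_le

lemma map_rotation_stdGaussian (θ : ℝ) :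
    ((stdGaussian E).prod (stdGaussian E)).map (ContinuousLinearMap.rotation θ)
      = (stdGaussian E).prod (stdGaussian E) := by
  exact IsGaussian.map_rotation_eq_self (integral_id_stdGaussian (E := E)) θ

lemma lintegral_norm_stdGaussian_ne_top :
    ∫⁻ x : E, ENNReal.ofReal ‖x‖ ∂(stdGaussian E) ≠ ⊤ := by
  have h : Integrable (fun x : E => x) (stdGaussian E) := IsGaussian.integrable_fun_id
  simpa [ofReal_norm, HasFiniteIntegral] using h.2.ne

open Metric in
/-- Increment of the distance function over a small rotation. -/
lemma lintegral_infDist_step_le {A : Set E} (hA : IsClosed A) (hne : A.Nonempty)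
    (hconv : Convex ℝ A) {h : ℝ} (h0 : 0 ≤ h)
    (hpi : h ≤ Real.pi) :
    ∫⁻ x, ∫⁻ z, ENNReal.ofReal
        (infDist x A - infDist (Real.cos h • x - Real.sin h • z) A)
        ∂(stdGaussian E) ∂(stdGaussian E)
      ≤ ENNReal.ofReal h * (ENNReal.ofReal (1 / √(2 * Real.pi)) * stdGaussian E Aᶜ)
        + ENNReal.ofReal (h ^ 2 / 2) * ∫⁻ x : E, ENNReal.ofReal ‖x‖ ∂(stdGaussian E) := by
  set c := ENNReal.ofReal (1 / √(2 * Real.pi))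
  have hpt : ∀ x : E, ∫⁻ z, ENNReal.ofReal
        (infDist x A - infDist (Real.cos h • x - Real.sin h • z) A) ∂(stdGaussian E)
      ≤ Aᶜ.indicator (fun _ => ENNReal.ofReal h * c) x
        + ENNReal.ofReal (h ^ 2 / 2) * ENNReal.ofReal ‖x‖ := by
    intro x
    by_cases hx : x ∈ A
    · have : ∀ z, ENNReal.ofReal (infDist x A
          - infDist (Real.cos h • x - Real.sin h • z) A) = 0 := fun z => by
        rw [infDist_zero_of_mem hx, ENNReal.ofReal_eq_zero]
        linarith [infDist_nonneg (x := Real.cos h • x - Real.sin h • z) (s := A)]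
      simp [this]
    · obtain ⟨v, hv, hsub⟩ := exists_subgradient_infDist hA hne hconv hx
      have hcos : 1 - Real.cos h ≤ h ^ 2 / 2 := by linarith [Real.one_sub_sq_div_two_le_cos (x := h)]
      have hcos0 : 0 ≤ 1 - Real.cos h := by linarith [Real.cos_le_one h]
      have hsin0 : 0 ≤ Real.sin h := Real.sin_nonneg_of_nonneg_of_le_pi h0 hpi
      have hbound : ∀ z, ENNReal.ofReal (infDist x A
          - infDist (Real.cos h • x - Real.sin h • z) A)
          ≤ ENNReal.ofReal h * ENNReal.ofReal (inner ℝ v z)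
            + ENNReal.ofReal (h ^ 2 / 2) * ENNReal.ofReal ‖x‖ := by
        intro z
        have h1 := hsub (Real.cos h • x - Real.sin h • z)
        have h2 : inner ℝ v (x - (Real.cos h • x - Real.sin h • z))
            = (1 - Real.cos h) * inner ℝ v x + Real.sin h * inner ℝ v z := by
          simp only [inner_sub_right, real_inner_smul_right]
          ring
        have h3 : inner ℝ v x ≤ ‖x‖ := by
          simpa [hv] using real_inner_le_norm v x
        rw [← ENNReal.ofReal_mul h0, ← ENNReal.ofReal_mul (by positivity)]
        have h4 : (1 - Real.cos h) * inner ℝ v x ≤ h ^ 2 / 2 * ‖x‖ :=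
          (mul_le_mul_of_nonneg_left h3 hcos0).trans
            (mul_le_mul_of_nonneg_right hcos (norm_nonneg x))
        rcases le_total 0 (inner ℝ v z : ℝ) with hz | hz
        · rw [← ENNReal.ofReal_add (by positivity) (by positivity)]
          refine ENNReal.ofReal_le_ofReal ?_
          have := mul_le_mul_of_nonneg_right (Real.sin_le h0) hz
          linarith
        · refine le_add_left (ENNReal.ofReal_le_ofReal ?_)
          have := mul_nonpos_of_nonneg_of_nonpos hsin0 hz
          linarith
      calc _ ≤ ∫⁻ z, (ENNReal.ofReal h * ENNReal.ofReal (inner ℝ v z)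
            + ENNReal.ofReal (h ^ 2 / 2) * ENNReal.ofReal ‖x‖) ∂(stdGaussian E) :=
          lintegral_mono hbound
        _ = ENNReal.ofReal h * ∫⁻ z, ENNReal.ofReal (inner ℝ v z) ∂(stdGaussian E)
            + ENNReal.ofReal (h ^ 2 / 2) * ENNReal.ofReal ‖x‖ := by
          rw [lintegral_add_right _ measurable_const, lintegral_const_mul _ (by fun_prop)]
          simp
        _ ≤ _ := by
          simp only [Set.indicator, Set.mem_compl_iff, hx, not_false_eq_true, if_true]
          gcongr
          exact lintegral_ofReal_inner_stdGaussian_le hv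
  refine (lintegral_mono hpt).trans (le_of_eq ?_)
  rw [lintegral_add_right _ (by fun_prop), lintegral_const_mul _ (by fun_prop),
    lintegral_indicator hA.measurableSet.compl, setLIntegral_const, mul_assoc]

open Metric Filter Topology in
/-- An integrated isoperimetric estimate for closed convex sets: the Gaussian mean distance to the
set is controlled by the measure of its complement. -/
lemma measure_mul_lintegral_infDist_le {A : Set E} (hA : IsClosed A) (hne : A.Nonempty)
    (hconv : Convex ℝ A) :
    stdGaussian E A * ∫⁻ x, ENNReal.ofReal (infDist x A) ∂(stdGaussian E)
      ≤ ENNReal.ofReal (Real.pi / 2) *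
        (ENNReal.ofReal (1 / √(2 * Real.pi)) * stdGaussian E Aᶜ) := by
  set μ := stdGaussian E with hμ
  set C := ENNReal.ofReal (1 / √(2 * Real.pi)) * μ Aᶜ
  set B := ∫⁻ x : E, ENNReal.ofReal ‖x‖ ∂μ with hB
  have hBtop : B ≠ ⊤ := lintegral_norm_stdGaussian_ne_top
  have hcont : Continuous fun x : E => infDist x A := continuous_infDist_pt A
  let X : ℝ → E × E → E := fun θ w => Real.cos θ • w.1 + Real.sin θ • w.2
  have hXcont : ∀ θ, Continuous (X θ) := fun θ => by fun_prop
  have hstep : ∀ (θ h : ℝ), 0 ≤ h → h ≤ Real.pi →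
      ∫⁻ w, ENNReal.ofReal (infDist (X θ w) A - infDist (X (θ - h) w) A) ∂(μ.prod μ)
        ≤ ENNReal.ofReal h * C + ENNReal.ofReal (h ^ 2 / 2) * B := by
    intro θ h h0 hpi
    have hmeas : Measurable fun w : E × E => ENNReal.ofReal
        (infDist w.1 A - infDist (Real.cos h • w.1 - Real.sin h • w.2) A) :=
      (Continuous.measurable (by fun_prop)).ennreal_ofReal
    have h1 : ∀ w, ENNReal.ofReal (infDist (X θ w) A - infDist (X (θ - h) w) A)
        = (fun w : E × E => ENNReal.ofReal
          (infDist w.1 A - infDist (Real.cos h • w.1 - Real.sin h • w.2) A))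
          (ContinuousLinearMap.rotation θ w) := by
      intro w
      simp only [ContinuousLinearMap.rotation_apply, X, Real.cos_sub, Real.sin_sub]
      congr 4
      module
    rw [lintegral_congr h1, ← lintegral_map hmeas (by fun_prop), map_rotation_stdGaussian,
      lintegral_prod _ hmeas.aemeasurable]
    exact lintegral_infDist_step_le hA hne hconv h0 hpi
  have hK : ∀ K : ℕ, 0 < K → μ A * ∫⁻ x, ENNReal.ofReal (infDist x A) ∂μ
      ≤ ENNReal.ofReal (Real.pi / 2) * C + ENNReal.ofReal (Real.pi ^ 2 / 8 / K) * B := by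
    intro K hK
    have hK' : (0 : ℝ) < K := by exact_mod_cast hK
    set h : ℝ := Real.pi / 2 / K with hh
    have hpos : 0 ≤ h := by positivity
    have hle : h ≤ Real.pi := by
      rw [hh, div_le_iff₀ hK']
      have : (1 : ℝ) ≤ K := by exact_mod_cast hK
      nlinarith [Real.pi_pos]
    have htel : ∀ w : E × E, ENNReal.ofReal (infDist w.2 A - infDist w.1 A)
        ≤ ∑ k ∈ Finset.range K, ENNReal.ofReal
          (infDist (X ((k + 1 : ℕ) * h) w) A - infDist (X ((k + 1 : ℕ) * h - h) w) A) := by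
      intro w
      refine le_trans (ENNReal.ofReal_le_ofReal (le_of_eq ?_)) (ENNReal.ofReal_finsetSum_le _ _)
      have h2 : ∀ k : ℕ, infDist (X ((k + 1 : ℕ) * h) w) A - infDist (X ((k + 1 : ℕ) * h - h) w) A
          = infDist (X ((k + 1 : ℕ) * h) w) A - infDist (X (k * h) w) A := by
        intro k
        congr 3
        push_cast
        ring
      simp_rw [h2]
      rw [Finset.sum_range_sub (fun k : ℕ => infDist (X (k * h) w) A)]
      have h3 : (K : ℝ) * h = Real.pi / 2 := by rw [hh]; field_simp
      simp [X, h3]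
    calc μ A * ∫⁻ x, ENNReal.ofReal (infDist x A) ∂μ
        = ∫⁻ w : E × E, A.indicator 1 w.1 * ENNReal.ofReal (infDist w.2 A) ∂(μ.prod μ) := by
          rw [lintegral_prod_mul (f := A.indicator 1)
            (g := fun x => ENNReal.ofReal (infDist x A))
            (measurable_one.indicator hA.measurableSet).aemeasurable
            (by fun_prop), lintegral_indicator_one hA.measurableSet]
      _ ≤ ∫⁻ w : E × E, ENNReal.ofReal (infDist w.2 A - infDist w.1 A) ∂(μ.prod μ) := by
          refine lintegral_mono fun w => ?_
          by_cases hw : w.1 ∈ A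
          · simp [hw, infDist_zero_of_mem hw]
          · simp [hw]
      _ ≤ ∫⁻ w : E × E, ∑ k ∈ Finset.range K, ENNReal.ofReal
          (infDist (X ((k + 1 : ℕ) * h) w) A - infDist (X ((k + 1 : ℕ) * h - h) w) A)
            ∂(μ.prod μ) := lintegral_mono htel
      _ = ∑ k ∈ Finset.range K, ∫⁻ w : E × E, ENNReal.ofReal
          (infDist (X ((k + 1 : ℕ) * h) w) A - infDist (X ((k + 1 : ℕ) * h - h) w) A)
            ∂(μ.prod μ) := by
          refine lintegral_finsetSum _ fun k _ =>
            (Continuous.measurable ?_).ennreal_ofReal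
          have := hXcont ((k + 1 : ℕ) * h)
          have := hXcont ((k + 1 : ℕ) * h - h)
          fun_prop
      _ ≤ ∑ k ∈ Finset.range K, (ENNReal.ofReal h * C + ENNReal.ofReal (h ^ 2 / 2) * B) :=
          Finset.sum_le_sum fun k _ => hstep _ h hpos hle
      _ = _ := by
          rw [Finset.sum_const, Finset.card_range, nsmul_eq_mul, mul_add,
            ← mul_assoc _ _ C, ← mul_assoc _ _ B,
            ← ENNReal.ofReal_natCast, ← ENNReal.ofReal_mul hK'.le, ← ENNReal.ofReal_mul hK'.le]
          have e1 : (K : ℝ) * h = Real.pi / 2 := by rw [hh]; field_simp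
          have e2 : (K : ℝ) * (h ^ 2 / 2) = Real.pi ^ 2 / 8 / K := by
            rw [hh]; field_simp; norm_num
          rw [e1, e2]
  have hlim : Tendsto (fun K : ℕ => ENNReal.ofReal (Real.pi / 2) * C
      + ENNReal.ofReal (Real.pi ^ 2 / 8 / K) * B) atTop
      (𝓝 (ENNReal.ofReal (Real.pi / 2) * C + ENNReal.ofReal 0 * B)) := by
    refine Tendsto.const_add _ (ENNReal.Tendsto.mul_const ?_ (Or.inr hBtop))
    exact ENNReal.tendsto_ofReal (tendsto_const_div_atTop_nhds_zero_nat _)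
  have := ge_of_tendsto hlim (eventually_atTop.2 ⟨1, fun K hK1 => hK K hK1⟩)
  simpa using this

end StdGaussian

section Lasso

variable {E ι : Type*} [NormedAddCommGroup E] [InnerProductSpace ℝ E] [Fintype ι]
  {L : (ι → ℝ) →ₗ[ℝ] E} {lam : ℝ}

/-- The variational inequality characterising the minimisers of the LASSO objective. -/
lemma inner_le_of_lasso_min (hlam : 0 ≤ lam) {y : E} {bh : ι → ℝ}
    (hmin : ∀ b : ι → ℝ, ‖y - L bh‖ ^ 2 + 2 * lam * ∑ j, |bh j|
      ≤ ‖y - L b‖ ^ 2 + 2 * lam * ∑ j, |b j|) (b : ι → ℝ) :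
    inner ℝ (y - L bh) (L b - L bh) ≤ lam * (∑ j, |b j| - ∑ j, |bh j|) := by
  set w := y - L bh with hw
  set d := L b - L bh with hd
  by_contra! hlt
  set G := inner ℝ w d - lam * (∑ j, |b j| - ∑ j, |bh j|) with hG
  have hGpos : 0 < G := by linarith
  have key : ∀ s : ℝ, 0 < s → s ≤ 1 → 2 * G ≤ s * ‖d‖ ^ 2 := by
    intro s h0 h1
    have h := hmin (bh + s • (b - bh))
    have e : y - L (bh + s • (b - bh)) = w - s • d := by
      simp only [map_add, map_smul, map_sub, hw, hd]
      abel
    have habs : ∑ j, |(bh + s • (b - bh)) j| ≤ (1 - s) * ∑ j, |bh j| + s * ∑ j, |b j| := by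
      rw [Finset.mul_sum, Finset.mul_sum, ← Finset.sum_add_distrib]
      refine Finset.sum_le_sum fun j _ => ?_
      have : (bh + s • (b - bh)) j = (1 - s) * bh j + s * b j := by
        simp only [Pi.add_apply, Pi.smul_apply, Pi.sub_apply, smul_eq_mul]
        ring
      rw [this]
      refine (abs_add_le _ _).trans (le_of_eq ?_)
      rw [abs_mul, abs_mul, abs_of_nonneg (sub_nonneg.2 h1), abs_of_pos h0]
    rw [e, norm_sub_sq_real w, real_inner_smul_right, norm_smul, Real.norm_of_nonneg h0.le] at h
    have h2 := mul_le_mul_of_nonneg_left habs hlam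
    have h3 : s * (2 * G) ≤ s * (s * ‖d‖ ^ 2) := by
      rw [hG]
      nlinarith
    exact le_of_mul_le_mul_left h3 h0
  have hpos : 0 < G + ‖d‖ ^ 2 := by positivity
  have := key (G / (G + ‖d‖ ^ 2)) (by positivity)
    ((div_le_one hpos).2 (by linarith [sq_nonneg ‖d‖]))
  rw [div_mul_eq_mul_div, le_div_iff₀ hpos] at this
  nlinarith [mul_pos hGpos hGpos, mul_nonneg hGpos.le (sq_nonneg ‖d‖)]

/-- The LASSO fit depends on the observation in a nonexpansive way. -/
lemma norm_sub_le_of_lasso_min (hlam : 0 ≤ lam) {y y' : E} {bh bh' : ι → ℝ}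
    (hmin : ∀ b : ι → ℝ, ‖y - L bh‖ ^ 2 + 2 * lam * ∑ j, |bh j|
      ≤ ‖y - L b‖ ^ 2 + 2 * lam * ∑ j, |b j|)
    (hmin' : ∀ b : ι → ℝ, ‖y' - L bh'‖ ^ 2 + 2 * lam * ∑ j, |bh' j|
      ≤ ‖y' - L b‖ ^ 2 + 2 * lam * ∑ j, |b j|) :
    ‖L bh - L bh'‖ ≤ ‖y - y'‖ := by
  have h1 := inner_le_of_lasso_min hlam hmin bh'
  have h2 := inner_le_of_lasso_min hlam hmin' bh
  have h3 := real_inner_le_norm (y - y') (L bh - L bh')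
  have h4 : inner ℝ (y - L bh) (L bh' - L bh) + inner ℝ (y' - L bh') (L bh - L bh')
      = ‖L bh - L bh'‖ ^ 2 - inner ℝ (y - y') (L bh - L bh') := by
    rw [← neg_sub (L bh) (L bh'), inner_neg_right, ← real_inner_self_eq_norm_sq, neg_add_eq_sub,
      ← inner_sub_left, ← inner_sub_left]
    congr 1
    abel
  by_contra! hlt
  nlinarith [norm_nonneg (y - y'), mul_lt_mul_of_pos_right hlt ((norm_nonneg _).trans_lt hlt)]

lemma lasso_error_le_add {f : E} {c : ℝ} (hlam : 0 ≤ lam) (hc : 0 < c)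
    {bh : E → ι → ℝ}
    (hmin : ∀ x b, ‖f + c • x - L (bh x)‖ ^ 2 + 2 * lam * ∑ j, |bh x j|
      ≤ ‖f + c • x - L b‖ ^ 2 + 2 * lam * ∑ j, |b j|) (x a : E) :
    c⁻¹ * ‖L (bh x) - f‖ ≤ c⁻¹ * ‖L (bh a) - f‖ + ‖x - a‖ := by
  have h1 := norm_sub_le_of_lasso_min hlam (hmin x) (hmin a)
  rw [add_sub_add_left_eq_sub, ← smul_sub, norm_smul, Real.norm_of_nonneg hc.le] at h1
  have h2 := norm_sub_le_norm_sub_add_norm_sub (L (bh x)) (L (bh a)) f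
  rw [inv_mul_le_iff₀ hc, mul_add, mul_inv_cancel_left₀ hc.ne']
  linarith

lemma lasso_basic_inequality [DecidableEq ι] (hlam : 0 ≤ lam) {f ξ : E} {bh b : ι → ℝ}
    (hmin : ∀ b : ι → ℝ, ‖f + ξ - L bh‖ ^ 2 + 2 * lam * ∑ j, |bh j|
      ≤ ‖f + ξ - L b‖ ^ 2 + 2 * lam * ∑ j, |b j|)
    {S : Finset ι} (hb : ∀ j ∉ S, b j = 0) {r : ℝ}
    (hr : ∀ j, |inner ℝ (L (Pi.single j 1)) ξ| ≤ r) :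
    inner ℝ (L bh - f) (L (bh - b))
      ≤ (lam + r) * ∑ j ∈ S, |(bh - b) j| - (lam - r) * ∑ j ∈ Sᶜ, |(bh - b) j| := by
  have h1 := inner_le_of_lasso_min hlam hmin b
  have h2 : inner ℝ (f + ξ - L bh) (L b - L bh)
      = inner ℝ (L bh - f) (L (bh - b)) - inner ℝ (L (bh - b)) ξ := by
    rw [real_inner_comm ξ, map_sub, ← neg_sub (L bh) (L b), inner_neg_right, ← inner_neg_left,
      ← inner_sub_left]
    congr 1
    abel
  have h3 : inner ℝ (L (bh - b)) ξ ≤ r * ∑ j, |(bh - b) j| := by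
    conv_lhs => rw [← Finset.univ_sum_single (bh - b)]
    rw [map_sum, sum_inner, Finset.mul_sum]
    refine Finset.sum_le_sum fun j _ => ?_
    have : (Pi.single j ((bh - b) j) : ι → ℝ) = (bh - b) j • Pi.single j 1 := by
      rw [← Pi.single_smul]
      simp
    rw [this, map_smul, real_inner_smul_left]
    refine (le_abs_self _).trans ?_
    rw [abs_mul, mul_comm]
    exact mul_le_mul_of_nonneg_right (hr j) (abs_nonneg _)
  have h4 : ∑ j, |b j| - ∑ j, |bh j|
      ≤ ∑ j ∈ S, |(bh - b) j| - ∑ j ∈ Sᶜ, |(bh - b) j| := by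
    rw [← Finset.sum_add_sum_compl S, ← Finset.sum_add_sum_compl S (fun j => |bh j|)]
    have h5 : ∑ j ∈ S, |b j| ≤ ∑ j ∈ S, |bh j| + ∑ j ∈ S, |(bh - b) j| := by
      rw [← Finset.sum_add_distrib]
      refine Finset.sum_le_sum fun j _ => ?_
      have := abs_sub_abs_le_abs_sub (b j) (bh j)
      rw [abs_sub_comm] at this
      simp only [Pi.sub_apply]
      linarith
    have h6 : ∑ j ∈ Sᶜ, |b j| = 0 := Finset.sum_eq_zero fun j hj => by
      rw [hb j (Finset.mem_compl.1 hj), abs_zero]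
    have h7 : ∑ j ∈ Sᶜ, |(bh - b) j| = ∑ j ∈ Sᶜ, |bh j| := Finset.sum_congr rfl fun j hj => by
      rw [Pi.sub_apply, hb j (Finset.mem_compl.1 hj), sub_zero]
    linarith
  have h8 := mul_le_mul_of_nonneg_left h4 hlam
  rw [← Finset.sum_add_sum_compl S (fun j => |(bh - b) j|)] at h3
  linarith

lemma norm_le_norm_of_inner_sub_nonpos {u v : E} (h : inner ℝ u (u - v) ≤ 0) : ‖u‖ ≤ ‖v‖ := by
  rw [inner_sub_right, real_inner_self_eq_norm_sq] at h
  have := real_inner_le_norm u v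
  by_contra! hlt
  nlinarith [norm_nonneg v, mul_lt_mul_of_pos_left hlt ((norm_nonneg _).trans_lt hlt)]

lemma norm_le_add_of_inner_sub_le {u v : E} {K : ℝ} (hK : 0 ≤ K)
    (h : inner ℝ u (u - v) ≤ K * ‖u - v‖) : ‖u‖ ≤ ‖v‖ + K := by
  have h1 : ‖v‖ ^ 2 = ‖u‖ ^ 2 - 2 * inner ℝ u (u - v) + ‖u - v‖ ^ 2 := by
    rw [← norm_sub_sq_real]
    congr 2
    abel
  refine abs_le_of_sq_le_sq' ?_ (by positivity) |>.2
  nlinarith [sq_nonneg (‖u - v‖ - K), norm_nonneg v]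

/-- Without active coordinates the LASSO fit is never worse than the zero fit as long as the noise
level does not exceed the tuning parameter. -/
lemma lasso_oracle_empty [DecidableEq ι] (hlam : 0 ≤ lam) {f ξ : E} {bh b : ι → ℝ}
    (hmin : ∀ b : ι → ℝ, ‖f + ξ - L bh‖ ^ 2 + 2 * lam * ∑ j, |bh j|
      ≤ ‖f + ξ - L b‖ ^ 2 + 2 * lam * ∑ j, |b j|)
    (hb : ∀ j, b j = 0) {r : ℝ} (hrlam : r ≤ lam)
    (hr : ∀ j, |inner ℝ (L (Pi.single j 1)) ξ| ≤ r) :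
    ‖L bh - f‖ ≤ ‖L b - f‖ := by
  have h := lasso_basic_inequality hlam hmin (S := ∅) (fun j _ => hb j) hr
  refine norm_le_norm_of_inner_sub_nonpos ?_
  rw [sub_sub_sub_cancel_right, ← map_sub]
  refine h.trans ?_
  have := mul_nonneg (sub_nonneg.2 hrlam)
    (Finset.sum_nonneg (fun j (_ : j ∈ (∅ : Finset ι)ᶜ) => abs_nonneg ((bh - b) j)))
  simpa using this

/-- Deterministic oracle inequality for the LASSO under a restricted eigenvalue condition. -/
lemma lasso_oracle [DecidableEq ι] (hlam : 0 ≤ lam) {f ξ : E} {bh b : ι → ℝ}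
    (hmin : ∀ b : ι → ℝ, ‖f + ξ - L bh‖ ^ 2 + 2 * lam * ∑ j, |bh j|
      ≤ ‖f + ξ - L b‖ ^ 2 + 2 * lam * ∑ j, |b j|)
    {S : Finset ι} (hS : S.Nonempty) (hb : ∀ j ∉ S, b j = 0) {κ : ℝ} (hκ0 : 0 < κ) (hκ1 : κ ≤ 1)
    (hκ : ∀ Δ : ι → ℝ, ∑ j ∈ Sᶜ, |Δ j| ≤ 3 * ∑ j ∈ S, |Δ j| → κ * √(∑ j, Δ j ^ 2) ≤ ‖L Δ‖)
    {r : ℝ} (hr0 : 0 ≤ r) (hrlam : r ≤ lam / 2)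
    (hr : ∀ j, |inner ℝ (L (Pi.single j 1)) ξ| ≤ r) :
    ‖L bh - f‖ ≤ ‖L b - f‖ + 3 * lam * √S.card / (2 * κ) - (lam / 2 - r) := by
  have hs : 1 ≤ √(S.card : ℝ) := by
    rw [Real.one_le_sqrt]
    exact_mod_cast hS.card_pos
  have hq : 1 ≤ √(S.card : ℝ) / κ := by
    rw [one_le_div hκ0]
    exact hκ1.trans hs
  have hrw : 3 * lam * √S.card / (2 * κ) = 3 / 2 * lam * (√S.card / κ) := by
    field_simp
  rw [hrw]
  rcases le_or_gt (inner ℝ (L bh - f) (L (bh - b))) 0 with h0 | h0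
  · have := norm_le_norm_of_inner_sub_nonpos (u := L bh - f) (v := L b - f)
      (by rwa [sub_sub_sub_cancel_right, ← map_sub])
    nlinarith
  · have h := lasso_basic_inequality hlam hmin hb hr
    set a := ∑ j ∈ S, |(bh - b) j| with ha
    set c := ∑ j ∈ Sᶜ, |(bh - b) j| with hc
    have ha0 : 0 ≤ a := Finset.sum_nonneg fun _ _ => abs_nonneg _
    have hc0 : 0 ≤ c := Finset.sum_nonneg fun _ _ => abs_nonneg _
    have hlam0 : 0 < lam := by
      refine hlam.lt_of_ne fun h0' => ?_
      have : r = 0 := by linarith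
      simp only [← h0', this] at h
      linarith
    have hcone : c ≤ 3 * a := by nlinarith
    have hRE := hκ (bh - b) hcone
    have hCS : a ≤ √S.card * √(∑ j, (bh - b) j ^ 2) := by
      rw [← Real.sqrt_mul (Nat.cast_nonneg _)]
      refine Real.le_sqrt_of_sq_le ?_
      refine (sq_sum_le_card_mul_sum_sq (s := S) (f := fun j => |(bh - b) j|)).trans ?_
      refine mul_le_mul_of_nonneg_left ?_ (Nat.cast_nonneg _)
      simp only [sq_abs]
      exact Finset.sum_le_univ_sum_of_nonneg fun _ => sq_nonneg _
    have haL : a ≤ √S.card / κ * ‖L (bh - b)‖ := by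
      rw [div_mul_eq_mul_div, le_div_iff₀ hκ0]
      nlinarith [Real.sqrt_nonneg (S.card : ℝ)]
    have := norm_le_add_of_inner_sub_le (u := L bh - f) (v := L b - f)
      (K := (lam + r) * (√S.card / κ)) (by positivity) (by
        rw [sub_sub_sub_cancel_right, ← map_sub]
        nlinarith [mul_nonneg (by linarith : 0 ≤ lam - r) hc0])
    nlinarith

end Lasso
lemma sqrt_two_pi_gt : 2.506 < √(2 * Real.pi) :=
  (Real.lt_sqrt (by norm_num)).2 (by linarith [Real.pi_gt_d4])

lemma sqrt_two_pi_lt : √(2 * Real.pi) < 2.507 :=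
  (Real.sqrt_lt' (by norm_num)).2 (by linarith [Real.pi_lt_d4])

lemma mul_two_mul_gaussianReal_Ioi_le {p : ℕ} (hp : 5 ≤ p) :
    (p : ℝ≥0∞) * (2 * gaussianReal 0 1 (Set.Ioi (√(2 * Real.log p))))
      ≤ ENNReal.ofReal (2 / (Real.pi + 2)) := by
  have hp5 : (5 : ℝ) ≤ p := by exact_mod_cast hp
  have hp0 : (0 : ℝ) < p := by linarith
  have hlog : 1.58 ≤ Real.log p := by
    have h1 := Real.log_le_log (by norm_num) hp5
    have h2 := Real.one_sub_inv_le_log_of_pos (x := 5 / 4) (by norm_num)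
    rw [Real.log_div (by norm_num) (by norm_num), show (4 : ℝ) = 2 ^ 2 by norm_num,
      Real.log_pow] at h2
    have := Real.log_two_gt_d9
    push_cast at h2
    norm_num at h2 ⊢
    linarith
  set t := √(2 * Real.log p) with ht
  have ht2 : t ^ 2 = 2 * Real.log p := Real.sq_sqrt (by linarith)
  have ht177 : 1.77 ≤ t := Real.le_sqrt_of_sq_le (by linarith)
  have ht0 : 0 < t := by linarith
  have hpdf : (p : ℝ) * gaussianPDFReal 0 1 t = (√(2 * Real.pi))⁻¹ := by
    rw [gaussianPDFReal_zero_one, ht2, show -(2 * Real.log p) / 2 = -Real.log p by ring,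
      Real.exp_neg, Real.exp_log hp0]
    field_simp
  calc (p : ℝ≥0∞) * (2 * gaussianReal 0 1 (Set.Ioi t))
      ≤ ENNReal.ofReal p * (ENNReal.ofReal 2 *
        ENNReal.ofReal (gaussianPDFReal 0 1 t * ((t ^ 2 + 2) / (t ^ 3 + 3 * t)))) := by
        rw [ENNReal.ofReal_natCast, ENNReal.ofReal_ofNat]
        gcongr
        exact gaussianReal_Ioi_le ht0
    _ ≤ _ := by
        rw [← ENNReal.ofReal_mul (by norm_num), ← ENNReal.ofReal_mul hp0.le]
        refine ENNReal.ofReal_le_ofReal ?_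
        have e : (p : ℝ) * (2 * (gaussianPDFReal 0 1 t * ((t ^ 2 + 2) / (t ^ 3 + 3 * t))))
            = 2 * (t ^ 2 + 2) / (√(2 * Real.pi) * (t ^ 3 + 3 * t)) := by
          calc _ = (p * gaussianPDFReal 0 1 t) * (2 * ((t ^ 2 + 2) / (t ^ 3 + 3 * t))) := by ring
            _ = _ := by rw [hpdf]; field_simp
        rw [e, div_le_div_iff₀ (by positivity) (by positivity)]
        have h1 : 2.506 * (t ^ 3 + 3 * t) ≤ √(2 * Real.pi) * (t ^ 3 + 3 * t) :=
          mul_le_mul_of_nonneg_right sqrt_two_pi_gt.le (by positivity)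
        have h2 : (Real.pi + 2) * (t ^ 2 + 2) ≤ 5.1416 * (t ^ 2 + 2) :=
          mul_le_mul_of_nonneg_right (by linarith [Real.pi_lt_d4]) (by positivity)
        have h3 : 5.1416 * (t ^ 2 + 2) ≤ 2.506 * (t ^ 3 + 3 * t) := by
          have hs := sub_nonneg.2 ht177
          nlinarith [mul_nonneg hs hs, mul_nonneg hs (mul_nonneg hs hs)]
        linarith

lemma small_dimension_bounds {p : ℕ} (hp : 2 ≤ p) (hp5 : p < 5) :
    √p - √(2 * Real.log p) ≤ 1 / √(2 * Real.pi) ∧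
      p / (8 * √(2 * Real.log p)) ≤ 1 / √(2 * Real.pi) := by
  have hc : 0.398 ≤ 1 / √(2 * Real.pi) := by
    rw [le_div_iff₀ (by positivity)]
    linarith [sqrt_two_pi_lt]
  have h2 := Real.log_two_gt_d9
  have key : ∃ c d : ℝ, 0 < c ∧ 0 ≤ d ∧ c ^ 2 ≤ 2 * Real.log p ∧ (p : ℝ) ≤ d ^ 2 ∧
      d - c ≤ 0.398 ∧ p ≤ 0.398 * (8 * c) := by
    interval_cases p
    · exact ⟨1.17, 1.415, by norm_num, by norm_num, by norm_num; linarith, by norm_num,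
        by norm_num, by norm_num⟩
    · have h3 := Real.one_sub_inv_le_log_of_pos (x := 3 / 2) (by norm_num)
      rw [Real.log_div (by norm_num) (by norm_num)] at h3
      exact ⟨1.43, 1.733, by norm_num, by norm_num, by norm_num at h3 ⊢; linarith, by norm_num,
        by norm_num, by norm_num⟩
    · have h4 : Real.log (4 : ℕ) = 2 * Real.log 2 := by
        rw [show ((4 : ℕ) : ℝ) = 2 ^ 2 by norm_num, Real.log_pow]
        norm_num
      exact ⟨1.66, 2, by norm_num, by norm_num, by rw [h4]; norm_num; linarith, by norm_num,
        by norm_num, by norm_num⟩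
  obtain ⟨c, d, hc0, hd0, hct, hpd, hdc, hpc⟩ := key
  have h3 : c ≤ √(2 * Real.log p) := Real.le_sqrt_of_sq_le hct
  have h4 : √(p : ℝ) ≤ d := Real.sqrt_le_iff.2 ⟨hd0, hpd⟩
  refine ⟨by linarith, le_trans ?_ hc⟩
  rw [div_le_iff₀ (by linarith)]
  linarith

section Slabs

variable {E ι : Type*} [NormedAddCommGroup E] [InnerProductSpace ℝ E]

lemma isClosed_slab (v : ι → E) (t : ℝ) : IsClosed {x | ∀ j, |inner ℝ (v j) x| ≤ t} := by
  simp only [Set.ofPred_forall]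
  exact isClosed_iInter fun j => isClosed_le (by fun_prop) continuous_const

lemma convex_slab (v : ι → E) (t : ℝ) : Convex ℝ {x | ∀ j, |inner ℝ (v j) x| ≤ t} := by
  intro x hx y hy a b ha hb hab j
  rw [inner_add_right, real_inner_smul_right, real_inner_smul_right]
  have hxj := hx j
  have hyj := hy j
  calc |a * inner ℝ (v j) x + b * inner ℝ (v j) y|
      ≤ a * |inner ℝ (v j) x| + b * |inner ℝ (v j) y| := by
        refine (abs_add_le _ _).trans (le_of_eq ?_)
        rw [abs_mul, abs_mul, abs_of_nonneg ha, abs_of_nonneg hb]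
    _ ≤ a * t + b * t := by gcongr
    _ = t := by rw [← add_mul, hab, one_mul]

lemma abs_inner_le_norm_starProjection {V : Submodule ℝ E} [V.HasOrthogonalProjection] {v : E}
    (hvV : v ∈ V) (hv : ‖v‖ ≤ 1) (x : E) : |inner ℝ v x| ≤ ‖V.starProjection x‖ := by
  have : inner ℝ v x = inner ℝ v (V.starProjection x) := by
    rw [← Submodule.inner_starProjection_left_eq_right, Submodule.starProjection_eq_self_iff.2 hvV]
  rw [this]
  exact (abs_real_inner_le_norm _ _).trans (mul_le_of_le_one_left (norm_nonneg _) hv)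

lemma exists_mem_slab_norm_sub_le {v : ι → E} {V : Submodule ℝ E} [V.HasOrthogonalProjection]
    (hvV : ∀ j, v j ∈ V) (hv : ∀ j, ‖v j‖ ≤ 1)
    {ρ : ℝ} (hρ : 0 ≤ ρ) (x : E) :
    ∃ a, (∀ j, |inner ℝ (v j) a| ≤ ρ) ∧ ‖x - a‖ ≤ max (‖V.starProjection x‖ - ρ) 0 := by
  set R := ‖V.starProjection x‖ with hR
  rcases le_or_gt R ρ with h | h
  · exact ⟨x, fun j => (abs_inner_le_norm_starProjection (hvV j) (hv j) x).trans h, by simp⟩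
  have hR0 : 0 < R := hρ.trans_lt h
  have hle : 0 ≤ 1 - ρ / R := sub_nonneg.2 ((div_le_one hR0).2 h.le)
  refine ⟨x - (1 - ρ / R) • V.starProjection x, fun j => ?_, ?_⟩
  · refine (abs_inner_le_norm_starProjection (hvV j) (hv j) _).trans (le_of_eq ?_)
    have : V.starProjection (x - (1 - ρ / R) • V.starProjection x)
        = (ρ / R) • V.starProjection x := by
      rw [map_sub, map_smul, Submodule.starProjection_eq_self_iff.2
        (Submodule.starProjection_apply_mem V x)]
      module
    rw [this, norm_smul, ← hR, Real.norm_of_nonneg (by positivity)]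
    field_simp
  · rw [sub_sub_cancel, norm_smul, ← hR, Real.norm_of_nonneg hle]
    refine le_max_of_le_left (le_of_eq ?_)
    field_simp

lemma abs_inner_smul_le {v x : E} {c ρ : ℝ} (hc : 0 < c) (h : |inner ℝ v x| ≤ ρ) :
    |inner ℝ v (c • x)| ≤ c * ρ := by
  rw [real_inner_smul_right, abs_mul, abs_of_pos hc]
  gcongr

end Slabs

section GaussianSlabs

variable {E ι : Type*} [NormedAddCommGroup E] [InnerProductSpace ℝ E] [FiniteDimensional ℝ E]
  [MeasurableSpace E] [BorelSpace E] [Fintype ι]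

lemma measure_lt_inner_stdGaussian {w : E} (hw : ‖w‖ = 1) (t : ℝ) :
    stdGaussian E {x | t < inner ℝ w x} = gaussianReal 0 1 (Set.Ioi t) := by
  have h := map_inner_stdGaussian w
  rw [hw, one_pow, Real.toNNReal_one] at h
  rw [← h, Measure.map_apply (by fun_prop) measurableSet_Ioi]
  rfl

lemma measure_lt_abs_inner_stdGaussian_le {v : E} (hv : ‖v‖ ≤ 1) {t : ℝ} (ht : 0 ≤ t) :
    stdGaussian E {x | t < |inner ℝ v x|} ≤ 2 * gaussianReal 0 1 (Set.Ioi t) := by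
  rcases eq_or_ne v 0 with rfl | hv0
  · have : {x : E | t < |inner ℝ (0 : E) x|} = ∅ := by
      ext x
      simpa using ht
    rw [this, measure_empty]
    exact zero_le
  have hpos : 0 < ‖v‖ := norm_pos_iff.2 hv0
  set w := ‖v‖⁻¹ • v with hw
  have hw1 : ‖w‖ = 1 := by simp [hw, norm_smul, hpos.ne']
  have hvw : v = ‖v‖ • w := by simp [hw, smul_smul, hpos.ne']
  have hsub : {x : E | t < |inner ℝ v x|}
      ⊆ {x | t < inner ℝ w x} ∪ {x | t < inner ℝ (-w) x} := by
    intro x hx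
    have hx' : t < |inner ℝ w x| := by
      rw [Set.mem_ofPred_eq, hvw, real_inner_smul_left, abs_mul, abs_of_pos hpos] at hx
      exact hx.trans_le (mul_le_of_le_one_left (abs_nonneg _) hv)
    simpa [inner_neg_left, lt_abs] using hx'
  refine (measure_mono hsub).trans ((measure_union_le _ _).trans (le_of_eq ?_))
  rw [measure_lt_inner_stdGaussian hw1, measure_lt_inner_stdGaussian (by rwa [norm_neg]), two_mul]

lemma measure_compl_slab_stdGaussian_le {v : ι → E} (hv : ∀ j, ‖v j‖ ≤ 1) {t : ℝ} (ht : 0 ≤ t) :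
    stdGaussian E {x | ∀ j, |inner ℝ (v j) x| ≤ t}ᶜ
      ≤ Fintype.card ι * (2 * gaussianReal 0 1 (Set.Ioi t)) := by
  have : {x : E | ∀ j, |inner ℝ (v j) x| ≤ t}ᶜ = ⋃ j, {x | t < |inner ℝ (v j) x|} := by
    ext x
    simp
  rw [this]
  refine (measure_iUnion_fintype_le _ _).trans
    ((Finset.sum_le_sum fun j _ => measure_lt_abs_inner_stdGaussian_le (hv j) ht).trans
      (le_of_eq ?_))
  rw [Finset.sum_const, nsmul_eq_mul, Finset.card_univ]

lemma lintegral_infDist_slab_le {v : ι → E} (hv : ∀ j, ‖v j‖ ≤ 1) (hι : 5 ≤ Fintype.card ι)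
    {τ : ℝ} (hτ : √(2 * Real.log (Fintype.card ι)) ≤ τ) :
    ∫⁻ x, ENNReal.ofReal (Metric.infDist x {x | ∀ j, |inner ℝ (v j) x| ≤ τ}) ∂(stdGaussian E)
      ≤ ENNReal.ofReal (1 / √(2 * Real.pi)) := by
  set t := √(2 * Real.log (Fintype.card ι))
  set A : Set E := {x | ∀ j, |inner ℝ (v j) x| ≤ τ}
  have hA : IsClosed A := isClosed_slab v τ
  have ht0 : 0 ≤ τ := (Real.sqrt_nonneg _).trans hτ
  have hne : A.Nonempty := ⟨0, fun j => by simpa using ht0⟩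
  have hmain := measure_mul_lintegral_infDist_le hA hne (convex_slab v τ)
  have hq : stdGaussian E Aᶜ ≤ ENNReal.ofReal (2 / (Real.pi + 2)) := by
    refine (measure_mono (Set.compl_subset_compl.2 fun x hx j => ?_)).trans
      ((measure_compl_slab_stdGaussian_le hv (Real.sqrt_nonneg _)).trans
        (mul_two_mul_gaussianReal_Ioi_le hι))
    exact (hx j).trans hτ
  have hα : ENNReal.ofReal (Real.pi / (Real.pi + 2)) ≤ stdGaussian E A := by
    have h1 := prob_add_prob_compl (μ := stdGaussian E) hA.measurableSet
    have h2 : (1 : ℝ≥0∞) = ENNReal.ofReal (Real.pi / (Real.pi + 2))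
        + ENNReal.ofReal (2 / (Real.pi + 2)) := by
      rw [← ENNReal.ofReal_add (by positivity) (by positivity), ← add_div, div_self (by positivity),
        ENNReal.ofReal_one]
    rw [h2] at h1
    exact (ENNReal.add_le_add_iff_right ENNReal.ofReal_ne_top).1
      (h1.ge.trans (add_le_add_right hq _))
  have hα0 : stdGaussian E A ≠ 0 := by
    refine (lt_of_lt_of_le ?_ hα).ne'
    rw [ENNReal.ofReal_pos]
    positivity
  refine (ENNReal.mul_le_mul_iff_right hα0 (measure_ne_top _ _)).1 (hmain.trans ?_)
  rw [mul_left_comm, mul_comm]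
  refine mul_le_mul_left (le_trans ?_ hα) _
  refine (mul_le_mul_right hq _).trans (le_of_eq ?_)
  rw [← ENNReal.ofReal_mul (by positivity)]
  congr 1
  field_simp

lemma lintegral_sq_inner_stdGaussian {w : E} (hw : ‖w‖ = 1) :
    ∫⁻ x, ENNReal.ofReal (inner ℝ w x ^ 2) ∂(stdGaussian E) = 1 := by
  have h := map_inner_stdGaussian w
  rw [hw, one_pow, Real.toNNReal_one] at h
  rw [← lintegral_map (f := fun t : ℝ => ENNReal.ofReal (t ^ 2)) (by fun_prop) (by fun_prop), h]
  have hv : ∫ t, t ^ 2 ∂(gaussianReal 0 1) = 1 := by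
    have := variance_id_gaussianReal (μ := 0) (v := 1)
    rw [variance_of_integral_eq_zero (by fun_prop) (by simp)] at this
    simpa using this
  rw [← ofReal_integral_eq_lintegral_ofReal, hv, ENNReal.ofReal_one]
  · exact (memLp_id_gaussianReal 2).integrable_sq
  · exact Filter.Eventually.of_forall fun t => sq_nonneg t

lemma lintegral_sq_norm_starProjection_stdGaussian (V : Submodule ℝ E) :
    ∫⁻ x, ENNReal.ofReal (‖V.starProjection x‖ ^ 2) ∂(stdGaussian E) = Module.finrank ℝ V := by
  set b := stdOrthonormalBasis ℝ V
  have h : ∀ x : E, ENNReal.ofReal (‖V.starProjection x‖ ^ 2)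
      = ∑ k, ENNReal.ofReal (inner ℝ (b k : E) x ^ 2) := by
    intro x
    rw [← ENNReal.ofReal_sum_of_nonneg fun _ _ => sq_nonneg _]
    congr 1
    have := b.sum_sq_norm_inner_right (V.orthogonalProjectionOnto x)
    rw [Submodule.starProjection_apply, ← Submodule.coe_norm, ← this]
    refine Finset.sum_congr rfl fun k _ => ?_
    rw [Submodule.inner_orthogonalProjectionOnto_eq_of_mem_left, Real.norm_eq_abs, sq_abs]
  rw [lintegral_congr h, lintegral_finsetSum _ fun k _ => by fun_prop]
  rw [Finset.sum_congr rfl fun k _ => lintegral_sq_inner_stdGaussian (w := (b k : E))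
    (b.orthonormal.1 k)]
  simp

end GaussianSlabs

section LipschitzExpectation

variable {E ι : Type*} [NormedAddCommGroup E] [InnerProductSpace ℝ E] [FiniteDimensional ℝ E]
  [MeasurableSpace E] [BorelSpace E] [Fintype ι]

/-- The mean of a Lipschitz function which is controlled on a slab at the universal level, when
there are many slab directions. -/
lemma lintegral_le_of_slab {v : ι → E} (hv : ∀ j, ‖v j‖ ≤ 1) (hι : 5 ≤ Fintype.card ι) {τ : ℝ}
    (hτ : √(2 * Real.log (Fintype.card ι)) ≤ τ) {Φ : E → ℝ}
    (hΦ : ∀ x a, Φ x ≤ Φ a + ‖x - a‖) {m : ℝ}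
    (hm : ∀ x, (∀ j, |inner ℝ (v j) x| ≤ τ) → Φ x ≤ m) :
    ∫⁻ x, ENNReal.ofReal (Φ x) ∂(stdGaussian E)
      ≤ ENNReal.ofReal m + ENNReal.ofReal (1 / √(2 * Real.pi)) := by
  have hA := isClosed_slab v τ
  have hne : {x : E | ∀ j, |inner ℝ (v j) x| ≤ τ}.Nonempty :=
    ⟨0, fun j => by simpa using (Real.sqrt_nonneg _).trans hτ⟩
  calc ∫⁻ x, ENNReal.ofReal (Φ x) ∂(stdGaussian E)
      ≤ ∫⁻ x, (ENNReal.ofReal m + ENNReal.ofReal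
          (Metric.infDist x {x | ∀ j, |inner ℝ (v j) x| ≤ τ})) ∂(stdGaussian E) :=
        lintegral_mono fun x => (ENNReal.ofReal_le_ofReal
          (le_add_infDist_of_forall_mem hΦ hA hne hm x)).trans ENNReal.ofReal_add_le
    _ = ENNReal.ofReal m + ∫⁻ x, ENNReal.ofReal
          (Metric.infDist x {x | ∀ j, |inner ℝ (v j) x| ≤ τ}) ∂(stdGaussian E) := by
        rw [lintegral_add_left measurable_const]
        simp
    _ ≤ _ := by
        gcongr
        exact lintegral_infDist_slab_le hv hι hτ

lemma lintegral_sq_norm_starProjection_span_le (v : ι → E) :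
    ∫⁻ x, ENNReal.ofReal (‖(Submodule.span ℝ (Set.range v)).starProjection x‖ ^ 2)
      ∂(stdGaussian E) ≤ ENNReal.ofReal (Fintype.card ι) := by
  rw [lintegral_sq_norm_starProjection_stdGaussian, ENNReal.ofReal_natCast]
  exact_mod_cast finrank_range_le_card v

/-- An affine function of the squared norm of a projection onto the span of finitely many vectors
has the expected Gaussian mean bound. -/
lemma lintegral_le_of_le_sq_norm_starProjection (v : ι → E) {Φ : E → ℝ} {a b : ℝ} (hb : 0 ≤ b)
    (h : ∀ x, Φ x ≤ a + b * ‖(Submodule.span ℝ (Set.range v)).starProjection x‖ ^ 2) :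
    ∫⁻ x, ENNReal.ofReal (Φ x) ∂(stdGaussian E)
      ≤ ENNReal.ofReal a + ENNReal.ofReal (b * Fintype.card ι) := by
  calc ∫⁻ x, ENNReal.ofReal (Φ x) ∂(stdGaussian E)
      ≤ ∫⁻ x, (ENNReal.ofReal a + ENNReal.ofReal b * ENNReal.ofReal
          (‖(Submodule.span ℝ (Set.range v)).starProjection x‖ ^ 2)) ∂(stdGaussian E) :=
        lintegral_mono fun x => by
          rw [← ENNReal.ofReal_mul hb]
          exact (ENNReal.ofReal_le_ofReal (h x)).trans ENNReal.ofReal_add_le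
    _ = ENNReal.ofReal a + ENNReal.ofReal b * ∫⁻ x, ENNReal.ofReal
          (‖(Submodule.span ℝ (Set.range v)).starProjection x‖ ^ 2) ∂(stdGaussian E) := by
        rw [lintegral_add_left measurable_const, lintegral_const_mul _ (by fun_prop)]
        simp
    _ ≤ _ := by
        rw [ENNReal.ofReal_mul hb]
        gcongr
        exact lintegral_sq_norm_starProjection_span_le v

/-- The mean of a Lipschitz function which is controlled on a slab at twice the universal level. -/
lemma lintegral_le_of_wide_slab {v : ι → E} (hv : ∀ j, ‖v j‖ ≤ 1) (hι : 2 ≤ Fintype.card ι) {τ : ℝ}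
    (hτ : √(2 * Real.log (Fintype.card ι)) ≤ τ) {Φ : E → ℝ}
    (hΦ : ∀ x a, Φ x ≤ Φ a + ‖x - a‖) {m : ℝ}
    (hm : ∀ x, (∀ j, |inner ℝ (v j) x| ≤ 2 * τ) → Φ x ≤ m) :
    ∫⁻ x, ENNReal.ofReal (Φ x) ∂(stdGaussian E)
      ≤ ENNReal.ofReal m + ENNReal.ofReal (1 / √(2 * Real.pi)) := by
  have hι1 : (1 : ℝ) < Fintype.card ι := by exact_mod_cast hι
  have ht : 0 < √(2 * Real.log (Fintype.card ι)) :=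
    Real.sqrt_pos.2 (mul_pos two_pos (Real.log_pos hι1))
  have hτ0 := ht.trans_le hτ
  rcases lt_or_ge (Fintype.card ι) 5 with h5 | h5
  · refine (lintegral_le_of_le_sq_norm_starProjection v (a := m) (b := 1 / (8 * τ))
      (by positivity) fun x => ?_).trans ?_
    · obtain ⟨a, ha, hxa⟩ := exists_mem_slab_norm_sub_le (V := Submodule.span ℝ (Set.range v))
        (fun j => Submodule.subset_span (Set.mem_range_self j)) hv (by positivity : 0 ≤ 2 * τ) x
      set R := ‖(Submodule.span ℝ (Set.range v)).starProjection x‖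
      have h1 : max (R - 2 * τ) 0 ≤ 1 / (8 * τ) * R ^ 2 := by
        refine max_le ?_ (by positivity)
        rw [one_div_mul_eq_div, le_div_iff₀ (by positivity)]
        nlinarith [sq_nonneg (R - 4 * τ)]
      linarith [hΦ x a, hm a ha]
    · gcongr
      refine le_trans ?_ (small_dimension_bounds hι h5).2
      rw [one_div_mul_eq_div]
      gcongr
  · exact lintegral_le_of_slab hv h5 hτ hΦ fun x hx => hm x fun j => (hx j).trans (by linarith)

/-- The mean of a Lipschitz function which decreases at unit speed inside a slab. -/
lemma lintegral_le_of_conic_slab {v : ι → E} (hv : ∀ j, ‖v j‖ ≤ 1) (hι : 2 ≤ Fintype.card ι)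
    {τ : ℝ} (hτ : √(2 * Real.log (Fintype.card ι)) ≤ τ) {Φ : E → ℝ}
    (hΦ : ∀ x a, Φ x ≤ Φ a + ‖x - a‖) {m : ℝ} (hmτ : τ ≤ m)
    (hm : ∀ x ρ, 0 ≤ ρ → ρ ≤ τ → (∀ j, |inner ℝ (v j) x| ≤ ρ) → Φ x ≤ m - (τ - ρ)) :
    ∫⁻ x, ENNReal.ofReal (Φ x) ∂(stdGaussian E)
      ≤ ENNReal.ofReal m + ENNReal.ofReal (1 / √(2 * Real.pi)) := by
  have hτ0 : 0 ≤ τ := (Real.sqrt_nonneg _).trans hτ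
  have hcard : (0 : ℝ) < Fintype.card ι := by
    have : 0 < Fintype.card ι := by omega
    exact_mod_cast this
  rcases lt_or_ge (Fintype.card ι) 5 with h5 | h5
  · set q := √(Fintype.card ι : ℝ) with hq
    have hq0 : 0 < q := Real.sqrt_pos.2 hcard
    have hqq : (Fintype.card ι : ℝ) = q * q := (Real.mul_self_sqrt hcard.le).symm
    refine (lintegral_le_of_le_sq_norm_starProjection v (a := m - τ + q / 2) (b := 1 / (2 * q))
      (by positivity) fun x => ?_).trans ?_
    · have hvV : ∀ j, v j ∈ Submodule.span ℝ (Set.range v) :=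
        fun j => Submodule.subset_span (Set.mem_range_self j)
      obtain ⟨a, ha, hxa⟩ := exists_mem_slab_norm_sub_le hvV hv hτ0 x
      set R := ‖(Submodule.span ℝ (Set.range v)).starProjection x‖ with hR
      have h1 : R ≤ q / 2 + 1 / (2 * q) * R ^ 2 := by
        have : q / 2 + 1 / (2 * q) * R ^ 2 - R = (R - q) ^ 2 / (2 * q) := by
          field_simp
          ring
        have h2 : 0 ≤ (R - q) ^ 2 / (2 * q) := by positivity
        linarith
      rcases le_total R τ with h | h
      · linarith [hm x R (norm_nonneg _) h fun j => abs_inner_le_norm_starProjection (hvV j) (hv j) x]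
      · rw [max_eq_left (by linarith)] at hxa
        linarith [hΦ x a, hm a τ hτ0 le_rfl ha]
    · rw [← ENNReal.ofReal_add (by linarith [hq0]) (by positivity),
        ← ENNReal.ofReal_add (by linarith) (by positivity)]
      refine ENNReal.ofReal_le_ofReal ?_
      have h1 := (small_dimension_bounds hι h5).1
      have h2 : 1 / (2 * q) * (Fintype.card ι : ℝ) = q / 2 := by
        rw [hqq]
        field_simp
      linarith
  · exact lintegral_le_of_slab hv h5 hτ hΦ fun x hx => by linarith [hm x τ hτ0 le_rfl hx]

end LipschitzExpectation

section ScaledNorm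

lemma scaledNorm_eq_norm {n : ℕ} (u : Fin n → ℝ) :
    scaledNorm u = ‖(√(n : ℝ))⁻¹ • (WithLp.toLp 2 u : EuclideanSpace ℝ (Fin n))‖ := by
  rw [norm_smul, Real.norm_of_nonneg (by positivity), EuclideanSpace.norm_eq, scaledNorm,
    Real.sqrt_div' _ (Nat.cast_nonneg n), inv_mul_eq_div]
  simp

lemma gaussianVec_eq_map (n : ℕ) (σ : ℝ) :
    gaussianVec n σ
      = (stdGaussian (EuclideanSpace ℝ (Fin n))).map (fun x => σ • WithLp.ofLp x) := by
  rw [← map_pi_eq_stdGaussian, Measure.map_map (by fun_prop) (by fun_prop)]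
  have h : (fun x : EuclideanSpace ℝ (Fin n) => σ • WithLp.ofLp x) ∘ WithLp.toLp 2
      = fun x i => σ * x i := by
    funext x i
    simp
  rw [h, Measure.pi_map_pi (f := fun _ t => σ * t) (fun _ => by fun_prop), gaussianVec]
  congr 1
  funext i
  rw [gaussianReal_map_const_mul, mul_zero, mul_one]
  rfl

/-- The squared restricted eigenvalue constant does not exceed any of the quotients. -/
lemma kappaSq_mul_le {n p : ℕ} (X : Matrix (Fin n) (Fin p) ℝ) (S : Finset (Fin p)) (c₀ : ℝ)
    {Δ : Fin p → ℝ} (hΔ : ∑ j ∈ Sᶜ, |Δ j| ≤ c₀ * ∑ j ∈ S, |Δ j|) :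
    kappaSq X S c₀ * ∑ j, Δ j ^ 2 ≤ scaledNorm (X.mulVec Δ) ^ 2 := by
  rcases eq_or_ne Δ 0 with rfl | h0
  · simp [sq_nonneg]
  have hpos : 0 < ∑ j, Δ j ^ 2 := by
    obtain ⟨j, hj⟩ := Function.ne_iff.1 h0
    exact Finset.sum_pos' (fun _ _ => sq_nonneg _) ⟨j, Finset.mem_univ j, sq_pos_of_ne_zero hj⟩
  rw [← le_div_iff₀ hpos]
  refine csInf_le ⟨0, ?_⟩ ⟨Δ, h0, hΔ, rfl⟩
  rintro r ⟨Δ', -, -, rfl⟩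
  positivity

end ScaledNorm

lemma lintegral_ofReal_le_of_inv_mul {α : Type*} [MeasurableSpace α] {μ : Measure α}
    {F : α → ℝ} {c M k : ℝ} (hc : 0 < c)
    (h : ∫⁻ x, ENNReal.ofReal (c⁻¹ * F x) ∂μ
      ≤ ENNReal.ofReal (c⁻¹ * M) + ENNReal.ofReal k) :
    ∫⁻ x, ENNReal.ofReal (F x) ∂μ ≤ ENNReal.ofReal M + ENNReal.ofReal (c * k) := by
  have h1 : ∀ x, ENNReal.ofReal (F x) = ENNReal.ofReal c * ENNReal.ofReal (c⁻¹ * F x) := fun x => by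
    rw [← ENNReal.ofReal_mul hc.le, mul_inv_cancel_left₀ hc.ne']
  rw [lintegral_congr h1, lintegral_const_mul' _ _ ENNReal.ofReal_ne_top]
  refine (mul_le_mul_right h _).trans (le_of_eq ?_)
  rw [mul_add, ← ENNReal.ofReal_mul hc.le, ← ENNReal.ofReal_mul hc.le, mul_inv_cancel_left₀ hc.ne']

section LassoExpectation

variable {E ι : Type*} [NormedAddCommGroup E] [InnerProductSpace ℝ E] [FiniteDimensional ℝ E]
  [MeasurableSpace E] [BorelSpace E] [Fintype ι] [DecidableEq ι]
  {L : (ι → ℝ) →ₗ[ℝ] E} {lam c : ℝ} {f : E} {bh : E → ι → ℝ}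

lemma lintegral_lasso_empty_le (hL : ∀ j, ‖L (Pi.single j 1)‖ ≤ 1) (hι : 2 ≤ Fintype.card ι)
    (hc : 0 < c) (hlam : 2 * c * √(2 * Real.log (Fintype.card ι)) ≤ lam)
    (hmin : ∀ x b, ‖f + c • x - L (bh x)‖ ^ 2 + 2 * lam * ∑ j, |bh x j|
      ≤ ‖f + c • x - L b‖ ^ 2 + 2 * lam * ∑ j, |b j|) {b : ι → ℝ} (hb : ∀ j, b j = 0) :
    ∫⁻ x, ENNReal.ofReal ‖L (bh x) - f‖ ∂(stdGaussian E)
      ≤ ENNReal.ofReal ‖L b - f‖ + ENNReal.ofReal (c * (1 / √(2 * Real.pi))) := by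
  have hlam0 : 0 ≤ lam := le_trans (by positivity) hlam
  refine lintegral_ofReal_le_of_inv_mul hc
    (lintegral_le_of_wide_slab hL hι (τ := lam / (2 * c))
      ((le_div_iff₀' (by positivity)).2 hlam) (lasso_error_le_add hlam0 hc hmin) fun x hx => ?_)
  have := lasso_oracle_empty hlam0 (hmin x) hb (r := c * (2 * (lam / (2 * c))))
    (le_of_eq (by field_simp)) fun j => abs_inner_smul_le hc (hx j)
  gcongr

lemma lintegral_lasso_le (hL : ∀ j, ‖L (Pi.single j 1)‖ ≤ 1) (hι : 2 ≤ Fintype.card ι)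
    (hc : 0 < c) (hlam : 2 * c * √(2 * Real.log (Fintype.card ι)) ≤ lam)
    (hmin : ∀ x b, ‖f + c • x - L (bh x)‖ ^ 2 + 2 * lam * ∑ j, |bh x j|
      ≤ ‖f + c • x - L b‖ ^ 2 + 2 * lam * ∑ j, |b j|)
    {S : Finset ι} (hS : S.Nonempty) {b : ι → ℝ} (hb : ∀ j ∉ S, b j = 0) {κ : ℝ} (hκ0 : 0 < κ)
    (hκ : ∀ Δ : ι → ℝ, ∑ j ∈ Sᶜ, |Δ j| ≤ 3 * ∑ j ∈ S, |Δ j| → κ * √(∑ j, Δ j ^ 2) ≤ ‖L Δ‖) :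
    ∫⁻ x, ENNReal.ofReal ‖L (bh x) - f‖ ∂(stdGaussian E)
      ≤ ENNReal.ofReal (‖L b - f‖ + 3 * lam * √S.card / (2 * κ))
        + ENNReal.ofReal (c * (1 / √(2 * Real.pi))) := by
  have hlam0 : 0 ≤ lam := le_trans (by positivity) hlam
  have hκ1 : κ ≤ 1 := by
    obtain ⟨j, hj⟩ := hS
    have h1 : ∀ i, |(Pi.single j 1 : ι → ℝ) i| = (Pi.single j 1 : ι → ℝ) i := fun i => by
      rw [abs_of_nonneg]
      exact (Pi.single_nonneg.2 zero_le_one : (0 : ι → ℝ) ≤ Pi.single j 1) i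
    have h2 : ∑ i, (Pi.single j 1 : ι → ℝ) i ^ 2 = 1 := by
      simp [Pi.single_apply]
    have h3 := hκ (Pi.single j 1) (by
      simp only [h1]
      simp [Pi.single_apply, hj])
    rw [h2, Real.sqrt_one, mul_one] at h3
    exact h3.trans (hL j)
  have hbig : lam ≤ 3 * lam * √S.card / (2 * κ) := by
    have hs : 1 ≤ √(S.card : ℝ) := by
      rw [Real.one_le_sqrt]
      exact_mod_cast hS.card_pos
    rw [le_div_iff₀ (by positivity)]
    nlinarith [mul_le_mul_of_nonneg_left hs hlam0, mul_le_mul_of_nonneg_left hκ1 hlam0]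
  refine lintegral_ofReal_le_of_inv_mul hc
    (lintegral_le_of_conic_slab hL hι (τ := lam / (2 * c))
      ((le_div_iff₀' (by positivity)).2 hlam) (lasso_error_le_add hlam0 hc hmin) ?_
      fun x ρ hρ0 hρ hx => ?_)
  · rw [div_le_iff₀ (by positivity)]
    have : c⁻¹ * (‖L b - f‖ + 3 * lam * √S.card / (2 * κ)) * (2 * c)
        = 2 * (‖L b - f‖ + 3 * lam * √S.card / (2 * κ)) := by
      rw [mul_comm c⁻¹, mul_assoc, mul_left_comm c⁻¹, inv_mul_cancel₀ hc.ne']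
      ring
    rw [this]
    linarith [norm_nonneg (L b - f)]
  · rw [le_div_iff₀ (by positivity)] at hρ
    have := lasso_oracle hlam0 (hmin x) hS hb hκ0 hκ1 hκ (r := c * ρ) (by positivity)
      (by linarith) fun j => abs_inner_smul_le hc (hx j)
    rw [inv_mul_le_iff₀ hc, mul_sub, mul_inv_cancel_left₀ hc.ne', mul_sub]
    have h2 : c * (lam / (2 * c)) = lam / 2 := by field_simp
    rwa [h2]

end LassoExpectation

/-- Oracle inequality in expectation for the LASSO.
The oracle bound (with the convention `a/0 = +∞`) is expressed in `ℝ≥0∞`. -/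
theorem stmt9 (n p : ℕ) (hn : 0 < n) (hp : 2 ≤ p) (σ : ℝ) (hσ : 0 < σ)
    (f : Fin n → ℝ) (X : Matrix (Fin n) (Fin p) ℝ)
    (hdiag : ∀ j : Fin p, (1 / n) * ∑ i, X i j ^ 2 ≤ 1)
    (lam : ℝ) (hlam : 2 * σ * Real.sqrt (2 * Real.log p / n) ≤ lam)
    (βhat : (Fin n → ℝ) → (Fin p → ℝ))
    (hmin : ∀ (y : Fin n → ℝ) (b : Fin p → ℝ),
      scaledNorm (y - X.mulVec (βhat y)) ^ 2 + 2 * lam * ∑ j, |βhat y j|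
        ≤ scaledNorm (y - X.mulVec b) ^ 2 + 2 * lam * ∑ j, |b j|) :
    ∫⁻ ξ, ENNReal.ofReal (scaledNorm (X.mulVec (βhat (f + ξ)) - f)) ∂(gaussianVec n σ)
      ≤ (⨅ (S : Finset (Fin p)) (β : Fin p → ℝ) (_ : Function.support β = ↑S),
          (ENNReal.ofReal (scaledNorm (X.mulVec β - f)) +
            ENNReal.ofReal (3 * lam * Real.sqrt S.card) /
              ENNReal.ofReal (2 * Real.sqrt (kappaSq X S 3))))
        + ENNReal.ofReal (σ / Real.sqrt (2 * Real.pi * n)) := by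
  have hn' : (0 : ℝ) < n := by exact_mod_cast hn
  have hsn : 0 < √(n : ℝ) := Real.sqrt_pos.2 hn'
  have hp' : (1 : ℝ) < p := by exact_mod_cast hp
  let J : (Fin n → ℝ) →ₗ[ℝ] EuclideanSpace ℝ (Fin n) :=
    (√(n : ℝ))⁻¹ • (WithLp.linearEquiv 2 ℝ (Fin n → ℝ)).symm.toLinearMap
  have hJ : ∀ u, scaledNorm u = ‖J u‖ := scaledNorm_eq_norm
  let L : (Fin p → ℝ) →ₗ[ℝ] EuclideanSpace ℝ (Fin n) := J ∘ₗ X.mulVecLin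
  have hLX : ∀ b, J (X.mulVec b) = L b := fun b => rfl
  set c := σ / √(n : ℝ) with hc
  have hc0 : 0 < c := by positivity
  have hJc : ∀ x : EuclideanSpace ℝ (Fin n), J (σ • WithLp.ofLp x) = c • x := fun x => by
    change (√(n : ℝ))⁻¹ • (WithLp.toLp 2 (σ • WithLp.ofLp x)) = c • x
    rw [WithLp.toLp_smul, WithLp.toLp_ofLp, smul_smul, inv_mul_eq_div]
  have hL : ∀ j, ‖L (Pi.single j 1)‖ ≤ 1 := fun j => by
    rw [← hLX, ← hJ, scaledNorm, Real.sqrt_le_iff]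
    simpa [div_eq_inv_mul] using hdiag j
  have hlam' : 2 * c * √(2 * Real.log (Fintype.card (Fin p))) ≤ lam := by
    refine le_trans (le_of_eq ?_) hlam
    rw [Fintype.card_fin, Real.sqrt_div' _ hn'.le, hc]
    ring
  have hlam0 : 0 < lam := by
    refine lt_of_lt_of_le ?_ hlam
    have := Real.log_pos hp'
    positivity
  let bh : EuclideanSpace ℝ (Fin n) → Fin p → ℝ := fun x => βhat (f + σ • WithLp.ofLp x)
  have hmin' : ∀ x b, ‖J f + c • x - L (bh x)‖ ^ 2 + 2 * lam * ∑ j, |bh x j|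
      ≤ ‖J f + c • x - L b‖ ^ 2 + 2 * lam * ∑ j, |b j| := fun x b => by
    have := hmin (f + σ • WithLp.ofLp x) b
    simpa only [hJ, map_sub, map_add, hJc, hLX] using this
  have hmap : ∫⁻ ξ, ENNReal.ofReal (scaledNorm (X.mulVec (βhat (f + ξ)) - f)) ∂(gaussianVec n σ)
      ≤ ∫⁻ x, ENNReal.ofReal ‖L (bh x) - J f‖ ∂(stdGaussian (EuclideanSpace ℝ (Fin n))) := by
    rw [gaussianVec_eq_map]
    refine (lintegral_map_le _ _).trans (le_of_eq (lintegral_congr fun x => ?_))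
    rw [hJ, map_sub, hLX]
  have hconst : σ / √(2 * Real.pi * n) = c * (1 / √(2 * Real.pi)) := by
    rw [hc, Real.sqrt_mul (by positivity)]
    field_simp
  simp only [ENNReal.iInf_add]
  refine le_iInf fun S => le_iInf fun b => le_iInf fun hb => hmap.trans ?_
  have hb0 : ∀ j ∉ S, b j = 0 := fun j hj =>
    Function.notMem_support.1 fun h => hj (Finset.mem_coe.1 (hb ▸ h))
  rw [hJ, map_sub, hLX, hconst]
  rcases S.eq_empty_or_nonempty with rfl | hS
  · refine (lintegral_lasso_empty_le hL (by simpa using hp) hc0 hlam' hmin'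
      fun j => hb0 j (Finset.notMem_empty j)).trans ?_
    gcongr
    exact le_self_add
  · rcases le_or_gt (kappaSq X S 3) 0 with hκ | hκ
    · have hpos : 0 < 3 * lam * √(S.card : ℝ) := by
        have : (0 : ℝ) < S.card := by exact_mod_cast hS.card_pos
        positivity
      rw [Real.sqrt_eq_zero_of_nonpos hκ, mul_zero, ENNReal.ofReal_zero,
        ENNReal.div_zero (ENNReal.ofReal_pos.2 hpos).ne']
      simp
    · have hκ0 := Real.sqrt_pos.2 hκ
      refine (lintegral_lasso_le hL (by simpa using hp) hc0 hlam' hmin' hS hb0 hκ0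
        fun Δ hΔ => ?_).trans ?_
      · have := kappaSq_mul_le X S 3 hΔ
        rw [← Real.sqrt_mul hκ.le]
        refine Real.sqrt_le_iff.2 ⟨norm_nonneg _, ?_⟩
        rwa [hJ, hLX] at this
      · rw [ENNReal.ofReal_add (norm_nonneg _) (by positivity),
          ENNReal.ofReal_div_of_pos (by positivity)]
end

section
/- Let G₁,…,G_M be a partition of {1,…,p}, let 𝕏 ∈ ℝ^{n×p}, f ∈ ℝⁿ, ξ ∈ ℝⁿ, y = f + ξ, and λ > 0. Let β̂ be any solution of the group LASSO problem min_{β∈ℝᵖ}( ‖y − 𝕏β‖² + 2λ∑_{k=1}^M |β_{G_k}|₂ ). If max_{k=1,…,M} (1/n)|𝕏_{G_k}ᵀξ|₂ ≤ λ/2, then ‖𝕏β̂ − f‖² ≤ min over S ⊆ {1,…,M} of [ min_{β∈ℝᵖ: 𝒦(β)=S} ‖𝕏β − f‖² + 9|S|λ²/(4κ_G²(S,3)) ], with the convention a/0 = +∞ for a > 0. -/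
open MeasureTheory
open scoped ENNReal

/-- `|β_{G_k}|₂`: the Euclidean norm of `β` restricted to the group `G k`. -/
noncomputable def groupNorm {p : ℕ} (G : Finset (Fin p)) (β : Fin p → ℝ) : ℝ :=
  Real.sqrt (∑ j ∈ G, β j ^ 2)

/-- The squared group Restricted Eigenvalue constant
`κ_G²(S,c₀) = min { ‖XΔ‖²/|Δ|₂² : Δ ≠ 0, ∑_{k∈Sᶜ}|Δ_{G_k}|₂ ≤ c₀ ∑_{k∈S}|Δ_{G_k}|₂ }`. -/
noncomputable def kappaGSq {n p M : ℕ} (X : Matrix (Fin n) (Fin p) ℝ)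
    (G : Fin M → Finset (Fin p)) (S : Finset (Fin M)) (c₀ : ℝ) : ℝ :=
  sInf {r | ∃ Δ : Fin p → ℝ, Δ ≠ 0 ∧
    (∑ k ∈ Sᶜ, groupNorm (G k) Δ) ≤ c₀ * ∑ k ∈ S, groupNorm (G k) Δ ∧
    r = scaledNorm (X.mulVec Δ) ^ 2 / ∑ j, Δ j ^ 2}

theorem scaledNorm_sq {n : ℕ} (u : Fin n → ℝ) : scaledNorm u ^ 2 = (∑ i, u i ^ 2) / n :=
  Real.sq_sqrt (by positivity)

theorem scaledNorm_add_smul_sq {n : ℕ} (u v : Fin n → ℝ) (t : ℝ) :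
    scaledNorm (u + t • v) ^ 2 =
      scaledNorm u ^ 2 + 2 * t * (u ⬝ᵥ v / n) + t ^ 2 * scaledNorm v ^ 2 := by
  have h : ∑ i, (u + t • v) i ^ 2 =
      ∑ i, u i ^ 2 + 2 * t * (u ⬝ᵥ v) + t ^ 2 * ∑ i, v i ^ 2 := by
    simp only [dotProduct, Finset.mul_sum, ← Finset.sum_add_distrib, Pi.add_apply,
      Pi.smul_apply, smul_eq_mul]
    exact Finset.sum_congr rfl fun i _ => by ring
  rw [scaledNorm_sq, scaledNorm_sq, scaledNorm_sq, h]
  ring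

section groupNorm

variable {p : ℕ} (G : Finset (Fin p))

theorem groupNorm_nonneg (a : Fin p → ℝ) : 0 ≤ groupNorm G a := Real.sqrt_nonneg _

theorem groupNorm_sq (a : Fin p → ℝ) : groupNorm G a ^ 2 = ∑ j ∈ G, a j ^ 2 :=
  Real.sq_sqrt (Finset.sum_nonneg fun _ _ => sq_nonneg _)

theorem sum_mul_le_groupNorm_mul_groupNorm (a b : Fin p → ℝ) :
    ∑ j ∈ G, a j * b j ≤ groupNorm G a * groupNorm G b :=
  Real.sum_mul_le_sqrt_mul_sqrt G a b

theorem groupNorm_add_le (a b : Fin p → ℝ) :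
    groupNorm G (a + b) ≤ groupNorm G a + groupNorm G b := by
  refine Real.sqrt_le_iff.2 ⟨add_nonneg (groupNorm_nonneg G a) (groupNorm_nonneg G b), ?_⟩
  have h : ∑ j ∈ G, (a + b) j ^ 2 =
      ∑ j ∈ G, a j ^ 2 + 2 * ∑ j ∈ G, a j * b j + ∑ j ∈ G, b j ^ 2 := by
    simp only [Finset.mul_sum, ← Finset.sum_add_distrib, Pi.add_apply]
    exact Finset.sum_congr rfl fun i _ => by ring
  rw [h, ← groupNorm_sq, ← groupNorm_sq]
  linarith [sum_mul_le_groupNorm_mul_groupNorm G a b,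
    add_sq (groupNorm G a) (groupNorm G b)]

theorem groupNorm_smul {t : ℝ} (ht : 0 ≤ t) (a : Fin p → ℝ) :
    groupNorm G (t • a) = t * groupNorm G a := by
  simp only [groupNorm, Pi.smul_apply, smul_eq_mul, mul_pow, ← Finset.mul_sum]
  rw [Real.sqrt_mul (sq_nonneg t), Real.sqrt_sq ht]

theorem groupNorm_sub_rev (a b : Fin p → ℝ) : groupNorm G (a - b) = groupNorm G (b - a) := by
  simp only [groupNorm, Pi.sub_apply]
  congr 1
  exact Finset.sum_congr rfl fun i _ => by ring

theorem groupNorm_sub_groupNorm_le (a b : Fin p → ℝ) :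
    groupNorm G b - groupNorm G a ≤ groupNorm G (a - b) := by
  have h := groupNorm_add_le G a (b - a)
  rw [add_sub_cancel, groupNorm_sub_rev G b a] at h
  linarith

end groupNorm

section partition

variable {p M : ℕ} {G : Fin M → Finset (Fin p)}

theorem sum_sum_eq_sum_of_partition (hdisj : ∀ k l : Fin M, k ≠ l → Disjoint (G k) (G l))
    (hcover : Finset.univ.biUnion G = (Finset.univ : Finset (Fin p))) (g : Fin p → ℝ) :
    ∑ k, ∑ j ∈ G k, g j = ∑ j, g j := by
  rw [← hcover, Finset.sum_biUnion fun k _ l _ h => hdisj k l h]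

/-- The support of `β` lies in the groups of `S`, so the groups off `S` only enter through `a`. -/
theorem sum_groupNorm_sub_sum_groupNorm_le {S : Finset (Fin M)} {β : Fin p → ℝ}
    (hS : ∀ k : Fin M, k ∈ S ↔ ∃ j ∈ G k, β j ≠ 0) (a : Fin p → ℝ) :
    ∑ k, groupNorm (G k) β - ∑ k, groupNorm (G k) a ≤
      ∑ k ∈ S, groupNorm (G k) (a - β) - ∑ k ∈ Sᶜ, groupNorm (G k) (a - β) := by
  have hin : ∑ k ∈ S, (groupNorm (G k) β - groupNorm (G k) a) ≤
      ∑ k ∈ S, groupNorm (G k) (a - β) :=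
    Finset.sum_le_sum fun k _ => groupNorm_sub_groupNorm_le (G k) a β
  have hout : ∑ k ∈ Sᶜ, (groupNorm (G k) β - groupNorm (G k) a) =
      ∑ k ∈ Sᶜ, -groupNorm (G k) (a - β) := by
    refine Finset.sum_congr rfl fun k hk => ?_
    have h0 : ∀ j ∈ G k, β j = 0 := by
      simpa [hS] using hk
    have h1 : groupNorm (G k) β = 0 := by
      rw [groupNorm, Finset.sum_eq_zero fun j hj => by simp [h0 j hj], Real.sqrt_zero]
    have h2 : groupNorm (G k) (a - β) = groupNorm (G k) a := by
      unfold groupNorm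
      congr 1
      exact Finset.sum_congr rfl fun j hj => by simp [h0 j hj]
    rw [h1, h2, zero_sub]
  rw [← Finset.sum_sub_distrib, ← Finset.sum_add_sum_compl S, hout, Finset.sum_neg_distrib]
  linarith

theorem sq_sum_groupNorm_le (hdisj : ∀ k l : Fin M, k ≠ l → Disjoint (G k) (G l))
    (hcover : Finset.univ.biUnion G = (Finset.univ : Finset (Fin p)))
    (S : Finset (Fin M)) (a : Fin p → ℝ) :
    (∑ k ∈ S, groupNorm (G k) a) ^ 2 ≤ S.card * ∑ j, a j ^ 2 := by
  refine sq_sum_le_card_mul_sum_sq.trans (mul_le_mul_of_nonneg_left ?_ (Nat.cast_nonneg _))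
  rw [← sum_sum_eq_sum_of_partition hdisj hcover]
  simp only [groupNorm_sq]
  exact Finset.sum_le_sum_of_subset_of_nonneg (Finset.subset_univ S)
    fun k _ _ => Finset.sum_nonneg fun _ _ => sq_nonneg _

theorem dotProduct_mulVec_le_of_group_bound {n : ℕ}
    (hdisj : ∀ k l : Fin M, k ≠ l → Disjoint (G k) (G l))
    (hcover : Finset.univ.biUnion G = (Finset.univ : Finset (Fin p)))
    (X : Matrix (Fin n) (Fin p) ℝ) (ξ : Fin n → ℝ) {c : ℝ}
    (h : ∀ k, (1 / n) * groupNorm (G k) (X.transpose.mulVec ξ) ≤ c) (a : Fin p → ℝ) :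
    ξ ⬝ᵥ X.mulVec a / n ≤ c * ∑ k, groupNorm (G k) a := by
  rw [Matrix.dotProduct_mulVec, ← Matrix.mulVec_transpose, dotProduct,
    ← sum_sum_eq_sum_of_partition hdisj hcover, Finset.sum_div, Finset.mul_sum]
  refine Finset.sum_le_sum fun k _ => ?_
  calc (∑ j ∈ G k, X.transpose.mulVec ξ j * a j) / n
      ≤ groupNorm (G k) (X.transpose.mulVec ξ) * groupNorm (G k) a / n := by
        gcongr
        exact sum_mul_le_groupNorm_mul_groupNorm _ _ _
    _ = (1 / n) * groupNorm (G k) (X.transpose.mulVec ξ) * groupNorm (G k) a := by ring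
    _ ≤ c * groupNorm (G k) a :=
        mul_le_mul_of_nonneg_right (h k) (groupNorm_nonneg _ _)

end partition

theorem le_of_forall_mem_Ioc_le_mul_add {c d N : ℝ} (hN : 0 ≤ N)
    (h : ∀ t : ℝ, 0 < t → t ≤ 1 → c ≤ t * N + d) : c ≤ d := by
  by_contra! hlt
  have hpos : 0 < N + (c - d) := by linarith
  have ht := h ((c - d) / (N + (c - d))) (div_pos (by linarith) hpos)
    ((div_le_one hpos).2 (by linarith))
  have : (c - d) / (N + (c - d)) * N < c - d := by
    rw [div_mul_eq_mul_div, div_lt_iff₀ hpos]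
    nlinarith
  linarith

/-- First-order optimality condition for the group LASSO. -/
theorem dotProduct_residual_le_of_groupLasso_min {n p M : ℕ} {G : Fin M → Finset (Fin p)}
    {X : Matrix (Fin n) (Fin p) ℝ} {y : Fin n → ℝ} {lam : ℝ} (hlam : 0 ≤ lam)
    {βhat : Fin p → ℝ}
    (hmin : ∀ b : Fin p → ℝ,
      scaledNorm (y - X.mulVec βhat) ^ 2 + 2 * lam * ∑ k, groupNorm (G k) βhat
        ≤ scaledNorm (y - X.mulVec b) ^ 2 + 2 * lam * ∑ k, groupNorm (G k) b)
    (β : Fin p → ℝ) :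
    (y - X.mulVec βhat) ⬝ᵥ X.mulVec (βhat - β) / n ≥
      lam * (∑ k, groupNorm (G k) βhat - ∑ k, groupNorm (G k) β) := by
  set u := y - X.mulVec βhat with hu
  set v := X.mulVec (βhat - β)
  have key : 2 * lam * (∑ k, groupNorm (G k) βhat - ∑ k, groupNorm (G k) β) ≤
      2 * (u ⬝ᵥ v / n) := by
    refine le_of_forall_mem_Ioc_le_mul_add (sq_nonneg (scaledNorm v)) fun t ht ht1 => ?_
    have hb := hmin ((1 - t) • βhat + t • β)
    have hres : y - X.mulVec ((1 - t) • βhat + t • β) = u + t • v := by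
      simp only [hu, v, Matrix.mulVec_add, Matrix.mulVec_sub, Matrix.mulVec_smul]
      module
    have hpen : ∑ k, groupNorm (G k) ((1 - t) • βhat + t • β) ≤
        (1 - t) * ∑ k, groupNorm (G k) βhat + t * ∑ k, groupNorm (G k) β := by
      rw [Finset.mul_sum, Finset.mul_sum, ← Finset.sum_add_distrib]
      refine Finset.sum_le_sum fun k _ => (groupNorm_add_le _ _ _).trans ?_
      rw [groupNorm_smul _ (by linarith), groupNorm_smul _ ht.le]
    rw [hres, scaledNorm_add_smul_sq] at hb
    have hpen' := mul_le_mul_of_nonneg_left hpen (by linarith : 0 ≤ 2 * lam)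
    refine le_of_mul_le_mul_left ?_ ht
    linarith
  linarith

theorem kappaGSq_mul_le {n p M : ℕ} {X : Matrix (Fin n) (Fin p) ℝ}
    {G : Fin M → Finset (Fin p)} {S : Finset (Fin M)} {c₀ : ℝ} {a : Fin p → ℝ}
    (ha : ∑ k ∈ Sᶜ, groupNorm (G k) a ≤ c₀ * ∑ k ∈ S, groupNorm (G k) a) :
    kappaGSq X G S c₀ * ∑ j, a j ^ 2 ≤ scaledNorm (X.mulVec a) ^ 2 := by
  rcases eq_or_ne a 0 with rfl | h0
  · simp [sq_nonneg]
  have hpos : 0 < ∑ j, a j ^ 2 := by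
    obtain ⟨j, hj⟩ := Function.ne_iff.1 h0
    exact Finset.sum_pos' (fun _ _ => sq_nonneg _) ⟨j, Finset.mem_univ j, sq_pos_of_ne_zero hj⟩
  rw [← le_div_iff₀ hpos]
  refine csInf_le ⟨0, ?_⟩ ⟨a, h0, ha, rfl⟩
  rintro r ⟨b, -, -, rfl⟩
  positivity

/-- Sharp oracle inequality for the group LASSO on the event
`max_k (1/n)|X_{G_k}ᵀξ|₂ ≤ λ/2`.  Here `𝒦(β) = S` is expressed as
`∀ k, k ∈ S ↔ β_{G_k} ≠ 0`, and the oracle bound (with the convention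
`a/0 = +∞`) is expressed in `ℝ≥0∞`. -/
theorem stmt10 (n p M : ℕ) (hn : 0 < n)
    (G : Fin M → Finset (Fin p))
    (hdisj : ∀ k l : Fin M, k ≠ l → Disjoint (G k) (G l))
    (hcover : Finset.univ.biUnion G = (Finset.univ : Finset (Fin p)))
    (X : Matrix (Fin n) (Fin p) ℝ) (f ξ y : Fin n → ℝ) (hy : y = f + ξ)
    (lam : ℝ) (hlam : 0 < lam)
    (βhat : Fin p → ℝ)
    (hmin : ∀ b : Fin p → ℝ,
      scaledNorm (y - X.mulVec βhat) ^ 2 + 2 * lam * ∑ k, groupNorm (G k) βhat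
        ≤ scaledNorm (y - X.mulVec b) ^ 2 + 2 * lam * ∑ k, groupNorm (G k) b)
    (hevent : ∀ k : Fin M,
      (1 / n) * Real.sqrt (∑ j ∈ G k, X.transpose.mulVec ξ j ^ 2) ≤ lam / 2) :
    ENNReal.ofReal (scaledNorm (X.mulVec βhat - f) ^ 2)
      ≤ ⨅ (S : Finset (Fin M)) (β : Fin p → ℝ)
          (_ : ∀ k : Fin M, k ∈ S ↔ ∃ j ∈ G k, β j ≠ 0),
          (ENNReal.ofReal (scaledNorm (X.mulVec β - f) ^ 2) +
            ENNReal.ofReal (9 * S.card * lam ^ 2) /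
              ENNReal.ofReal (4 * kappaGSq X G S 3)) := by
  refine le_iInf fun S => le_iInf fun β => le_iInf fun hS => ?_
  set A := ∑ k ∈ S, groupNorm (G k) (βhat - β) with hA
  set B := ∑ k ∈ Sᶜ, groupNorm (G k) (βhat - β) with hB
  have hA0 : 0 ≤ A := Finset.sum_nonneg fun k _ => groupNorm_nonneg _ _
  have hB0 : 0 ≤ B := Finset.sum_nonneg fun k _ => groupNorm_nonneg _ _
  have hbasic : scaledNorm (X.mulVec βhat - f) ^ 2 + scaledNorm (X.mulVec (βhat - β)) ^ 2 ≤
      scaledNorm (X.mulVec β - f) ^ 2 + 3 * lam * A - lam * B := by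
    have hopt := dotProduct_residual_le_of_groupLasso_min hlam.le hmin β
    have hnoise := dotProduct_mulVec_le_of_group_bound hdisj hcover X ξ hevent (βhat - β)
    rw [← Finset.sum_add_sum_compl S, ← hA, ← hB] at hnoise
    have hpen := mul_le_mul_of_nonneg_left (sum_groupNorm_sub_sum_groupNorm_le hS βhat) hlam.le
    have hexp := scaledNorm_add_smul_sq (X.mulVec βhat - f) (X.mulVec (βhat - β)) (-1)
    have hβ : X.mulVec βhat - f + (-1 : ℝ) • X.mulVec (βhat - β) = X.mulVec β - f := by
      rw [Matrix.mulVec_sub]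
      module
    have hy' : y - X.mulVec βhat = ξ - (X.mulVec βhat - f) := by
      rw [hy]
      abel
    rw [hβ] at hexp
    rw [hy', sub_dotProduct, sub_div] at hopt
    linarith
  by_cases hcone : B ≤ 3 * A
  swap
  · refine le_add_right (ENNReal.ofReal_le_ofReal ?_)
    nlinarith [sq_nonneg (scaledNorm (X.mulVec (βhat - β)))]
  rcases S.eq_empty_or_nonempty with rfl | hne
  · refine le_add_right (ENNReal.ofReal_le_ofReal ?_)
    have : A = 0 := by simp [hA]
    rw [this] at hbasic
    nlinarith [sq_nonneg (scaledNorm (X.mulVec (βhat - β)))]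
  have hcard : (0 : ℝ) < S.card := by exact_mod_cast hne.card_pos
  rcases le_or_gt (kappaGSq X G S 3) 0 with hκ | hκ
  · rw [ENNReal.ofReal_of_nonpos (by linarith : 4 * kappaGSq X G S 3 ≤ 0),
      ENNReal.div_zero (by simp only [ne_eq, ENNReal.ofReal_eq_zero, not_le]; positivity)]
    simp
  rw [← ENNReal.ofReal_div_of_pos (by positivity),
    ← ENNReal.ofReal_add (sq_nonneg _) (by positivity)]
  refine ENNReal.ofReal_le_ofReal ?_
  set κ := kappaGSq X G S 3
  set N := scaledNorm (X.mulVec (βhat - β))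
  have hre : κ * A ^ 2 ≤ S.card * N ^ 2 := by
    calc κ * A ^ 2 ≤ κ * (S.card * ∑ j, (βhat - β) j ^ 2) :=
          mul_le_mul_of_nonneg_left (sq_sum_groupNorm_le hdisj hcover S _) hκ.le
      _ = S.card * (κ * ∑ j, (βhat - β) j ^ 2) := by ring
      _ ≤ S.card * N ^ 2 := mul_le_mul_of_nonneg_left (kappaGSq_mul_le hcone) hcard.le
  have hyoung : 3 * lam * A ≤ κ * A ^ 2 / S.card + 9 * S.card * lam ^ 2 / (4 * κ) := by
    have : κ * A ^ 2 / S.card + 9 * S.card * lam ^ 2 / (4 * κ) - 3 * lam * A =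
        (2 * κ * A - 3 * lam * S.card) ^ 2 / (4 * κ * S.card) := by
      field_simp
      ring
    have h0 : 0 ≤ (2 * κ * A - 3 * lam * S.card) ^ 2 / (4 * κ * S.card) := by positivity
    linarith
  have hdiv : κ * A ^ 2 / S.card ≤ N ^ 2 := by
    rw [div_le_iff₀ hcard]
    linarith
  nlinarith
end

section
/- Let G₁,…,G_M be a partition of {1,…,p} with each |G_k| = T = p/M, let ξ ∼ N(0, σ²I_{n×n}), and assume the diagonal elements of (1/n)𝕏ᵀ𝕏 are at most 1. Let ψ* = max_{k=1,…,M} ‖𝕏_{G_k}‖_sp/√n, where ‖·‖_sp is the spectral norm. If λ ≥ (2σ/√n)( √T + ψ*√(2 log(2M)) ), then P( max_{k=1,…,M} (1/n)|𝕏_{G_k}ᵀξ|₂ ≤ λ/2 ) ≥ 1/2. -/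
open MeasureTheory ProbabilityTheory
open scoped ENNReal

/-- The spectral norm `‖X_{G}‖_sp = sup_{|x|₂ ≤ 1} |X_{G} x|₂` of the submatrix of `X`
with columns indexed by `G`, expressed via vectors supported on `G`. -/
noncomputable def subSpecNorm {n p : ℕ} (X : Matrix (Fin n) (Fin p) ℝ)
    (G : Finset (Fin p)) : ℝ :=
  sSup {r | ∃ x : Fin p → ℝ, (∀ j ∉ G, x j = 0) ∧ (∑ j, x j ^ 2) ≤ 1 ∧
    r = Real.sqrt (∑ i, X.mulVec x i ^ 2)}

section GaussianQuadraticForm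

open Matrix

lemma lintegral_exp_mul_sq_gaussianReal_le {u : ℝ} (hu : 2 * u < 1) :
    ∫⁻ x, ENNReal.ofReal (Real.exp (u * x ^ 2)) ∂(gaussianReal 0 1)
      ≤ ENNReal.ofReal (Real.exp (u / (1 - 2 * u))) := by
  have hb : 0 < 1 / 2 - u := by linarith
  have hpdf : ∀ x : ℝ, gaussianPDFReal 0 1 x * Real.exp (u * x ^ 2)
      = (√(2 * Real.pi))⁻¹ * Real.exp (-(1 / 2 - u) * x ^ 2) := by
    intro x
    rw [gaussianPDFReal, mul_assoc, ← Real.exp_add]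
    simp only [NNReal.coe_one, mul_one, sub_zero]
    congr 2
    ring
  rw [gaussianReal_of_var_ne_zero 0 one_ne_zero,
    lintegral_withDensity_eq_lintegral_mul _ (measurable_gaussianPDF 0 1) (by fun_prop)]
  simp only [Pi.mul_apply, gaussianPDF,
    ← ENNReal.ofReal_mul (gaussianPDFReal_nonneg 0 1 _), hpdf]
  rw [← ofReal_integral_eq_lintegral_ofReal ((integrable_exp_neg_mul_sq hb).const_mul _)
    (ae_of_all _ fun x ↦ by positivity), integral_const_mul, integral_gaussian]
  apply ENNReal.ofReal_le_ofReal
  have h1 : 0 < 1 - 2 * u := by linarith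
  have h2 : (√(2 * Real.pi))⁻¹ * √(Real.pi / (1 / 2 - u)) = √(1 - 2 * u)⁻¹ := by
    rw [← Real.sqrt_inv, ← Real.sqrt_mul (by positivity)]
    congr 1
    have := Real.pi_pos
    have h3 : 1 / 2 - u = (1 - 2 * u) / 2 := by ring
    rw [h3]
    field_simp
  rw [h2]
  apply Real.sqrt_le_iff.2 ⟨(Real.exp_pos _).le, ?_⟩
  rw [← Real.exp_nat_mul]
  have h4 : ((2 : ℕ) : ℝ) * (u / (1 - 2 * u)) = (1 - 2 * u)⁻¹ - 1 := by
    push_cast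
    field_simp
    ring
  rw [h4]
  linarith [Real.add_one_le_exp ((1 - 2 * u)⁻¹ - 1)]

variable {ι : Type*} [Fintype ι]

lemma lintegral_exp_weighted_sum_sq_le {w : ι → ℝ} {L a s : ℝ} (hw : ∀ i, 0 ≤ w i)
    (hwL : ∀ i, w i ≤ L) (hwa : ∑ i, w i ≤ a) (hs : 0 ≤ s) (hsL : 2 * (s * L) < 1) :
    ∫⁻ x, ENNReal.ofReal (Real.exp (s * ∑ i, w i * x i ^ 2))
        ∂(Measure.pi fun _ : ι ↦ gaussianReal 0 1)
      ≤ ENNReal.ofReal (Real.exp (s * a / (1 - 2 * (s * L)))) := by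
  have hsw : ∀ i, s * w i ≤ s * L := fun i ↦ mul_le_mul_of_nonneg_left (hwL i) hs
  have hexp : ∀ x : ι → ℝ, ENNReal.ofReal (Real.exp (s * ∑ i, w i * x i ^ 2))
      = ∏ i, ENNReal.ofReal (Real.exp (s * w i * x i ^ 2)) := by
    intro x
    rw [← ENNReal.ofReal_prod_of_nonneg fun i _ ↦ (Real.exp_pos _).le, ← Real.exp_sum,
      Finset.mul_sum]
    simp only [mul_assoc]
  have hind : iIndepFun (fun i (x : ι → ℝ) ↦ ENNReal.ofReal (Real.exp (s * w i * x i ^ 2)))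
      (Measure.pi fun _ : ι ↦ gaussianReal 0 1) :=
    iIndepFun_pi (X := fun i (y : ℝ) ↦ ENNReal.ofReal (Real.exp (s * w i * y ^ 2)))
      fun i ↦ by fun_prop
  simp only [hexp]
  rw [lintegral_prod_eq_prod_lintegral_of_indepFun _ _ hind fun i ↦ by fun_prop]
  have hmarg : ∀ i, ∫⁻ x : ι → ℝ, ENNReal.ofReal (Real.exp (s * w i * x i ^ 2))
        ∂(Measure.pi fun _ : ι ↦ gaussianReal 0 1)
      = ∫⁻ y, ENNReal.ofReal (Real.exp (s * w i * y ^ 2)) ∂(gaussianReal 0 1) := fun i ↦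
    (measurePreserving_eval (fun _ : ι ↦ gaussianReal 0 1) i).lintegral_comp
      (f := fun y : ℝ ↦ ENNReal.ofReal (Real.exp (s * w i * y ^ 2))) (by fun_prop)
  simp only [hmarg]
  have hpos : 0 < 1 - 2 * (s * L) := by linarith
  calc ∏ i, ∫⁻ y, ENNReal.ofReal (Real.exp (s * w i * y ^ 2)) ∂(gaussianReal 0 1)
      ≤ ∏ i, ENNReal.ofReal (Real.exp (s * w i / (1 - 2 * (s * L)))) := by
        refine Finset.prod_le_prod' fun i _ ↦
          (lintegral_exp_mul_sq_gaussianReal_le (by linarith [hsw i])).trans ?_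
        gcongr
        · exact mul_nonneg hs (hw i)
        · exact hwL i
    _ = ENNReal.ofReal (Real.exp (s * (∑ i, w i) / (1 - 2 * (s * L)))) := by
        rw [← ENNReal.ofReal_prod_of_nonneg fun i _ ↦ (Real.exp_pos _).le, ← Real.exp_sum,
          Finset.mul_sum, Finset.sum_div]
    _ ≤ _ := by gcongr

/-- A Laurent–Massart type bound, obtained by Chernoff's method. -/
lemma pi_gaussianReal_weighted_sum_sq_ge_le {w : ι → ℝ} {L a t : ℝ} (hw : ∀ i, 0 ≤ w i)
    (hwL : ∀ i, w i ≤ L) (hwa : ∑ i, w i ≤ a) (hL : 0 < L) (ha : 0 < a) (ht : 0 ≤ t) :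
    (Measure.pi fun _ : ι ↦ gaussianReal 0 1)
        {x | (√a + √(2 * L * t)) ^ 2 ≤ ∑ i, w i * x i ^ 2}
      ≤ ENNReal.ofReal (Real.exp (-t)) := by
  set b := √a
  set c := √(2 * L * t)
  have hb : 0 < b := Real.sqrt_pos.2 ha
  have hb2 : b ^ 2 = a := Real.sq_sqrt ha.le
  have hc : 0 ≤ c := Real.sqrt_nonneg _
  have hc2 : c ^ 2 = 2 * L * t := Real.sq_sqrt (by positivity)
  set s := c / (b + c) / (2 * L)
  have hs : 0 ≤ s := by positivity
  have hsL : 1 - 2 * (s * L) = b / (b + c) := by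
    simp only [s]
    field_simp
    ring
  have hsL' : 2 * (s * L) < 1 := by
    have : 0 < b / (b + c) := by positivity
    linarith
  have hexponent : s * a / (1 - 2 * (s * L)) - s * (b + c) ^ 2 = -t := by
    have htc : t = c ^ 2 / (2 * L) := by rw [hc2]; field_simp
    rw [hsL, ← hb2, htc]
    simp only [s]
    field_simp
    ring
  have hmarkov := meas_ge_le_lintegral_div (μ := Measure.pi fun _ : ι ↦ gaussianReal 0 1)
    (f := fun x ↦ ENNReal.ofReal (Real.exp (s * ∑ i, w i * x i ^ 2)))
    (Measurable.aemeasurable (by fun_prop))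
    (ε := ENNReal.ofReal (Real.exp (s * (b + c) ^ 2)))
    (by simpa using Real.exp_pos _) ENNReal.ofReal_ne_top
  calc _ ≤ _ := measure_mono fun x hx ↦ by
        simp only [Set.mem_ofPred_eq] at hx ⊢
        gcongr
    _ ≤ _ := hmarkov
    _ ≤ ENNReal.ofReal (Real.exp (s * a / (1 - 2 * (s * L))))
          / ENNReal.ofReal (Real.exp (s * (b + c) ^ 2)) := by
        gcongr
        exact lintegral_exp_weighted_sum_sq_le hw hwL hwa hs hsL'
    _ = _ := by
        rw [← ENNReal.ofReal_div_of_pos (Real.exp_pos _), ← Real.exp_sub, hexponent]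

lemma pi_gaussianReal_map_orthonormalBasis (b : OrthonormalBasis ι ℝ (EuclideanSpace ℝ ι)) :
    (Measure.pi fun _ : ι ↦ gaussianReal 0 1).map (fun x ↦ (Matrix.of fun i j ↦ b j i) *ᵥ x)
      = Measure.pi fun _ : ι ↦ gaussianReal 0 1 := by
  have h := map_pi_eq_stdGaussian (ι := ι)
  rw [stdGaussian_eq_map_pi_orthonormalBasis b] at h
  have h' := congrArg (Measure.map (WithLp.ofLp (p := 2) (V := ι → ℝ))) h
  rw [Measure.map_map (by fun_prop) (by fun_prop),
    Measure.map_map (by fun_prop) (by fun_prop)] at h'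
  have hid : (WithLp.ofLp (p := 2) (V := ι → ℝ)) ∘ WithLp.toLp 2 = id := rfl
  rw [hid, Measure.map_id] at h'
  conv_rhs => rw [h']
  congr 1
  ext x i
  simp [Matrix.mulVec, dotProduct, mul_comm]

variable [DecidableEq ι]

/-- Tail bound for a positive semidefinite quadratic form in a standard Gaussian vector. -/
lemma pi_gaussianReal_quadForm_ge_le {B : Matrix ι ι ℝ} (hB : B.PosSemidef) {L a t : ℝ}
    (hBL : ∀ x, x ⬝ᵥ B *ᵥ x ≤ L * (x ⬝ᵥ x)) (hBa : B.trace ≤ a)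
    (hL : 0 < L) (ha : 0 < a) (ht : 0 ≤ t) :
    (Measure.pi fun _ : ι ↦ gaussianReal 0 1)
        {x | (√a + √(2 * L * t)) ^ 2 ≤ x ⬝ᵥ B *ᵥ x}
      ≤ ENNReal.ofReal (Real.exp (-t)) := by
  set U := hB.1.eigenvectorUnitary
  have hquad : ∀ x, ((U : Matrix ι ι ℝ) *ᵥ x) ⬝ᵥ B *ᵥ ((U : Matrix ι ι ℝ) *ᵥ x)
      = ∑ i, hB.1.eigenvalues i * x i ^ 2 := fun x ↦ by
    have hD := hB.1.conjStarAlgAut_star_eigenvectorUnitary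
    rw [Unitary.conjStarAlgAut_star_apply] at hD
    rw [dotProduct_comm, dotProduct_mulVec, ← mulVec_transpose, mulVec_mulVec, mulVec_mulVec,
      ← conjTranspose_eq_transpose_of_trivial, ← star_eq_conjTranspose, hD, dotProduct_comm]
    simp only [dotProduct, mulVec_diagonal, Function.comp_apply, RCLike.ofReal_real_eq_id, id]
    exact Finset.sum_congr rfl fun i _ ↦ by ring
  have hnorm : ∀ x, ((U : Matrix ι ι ℝ) *ᵥ x) ⬝ᵥ ((U : Matrix ι ι ℝ) *ᵥ x) = x ⬝ᵥ x := fun x ↦ by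
    rw [dotProduct_mulVec, ← mulVec_transpose, mulVec_mulVec,
      ← conjTranspose_eq_transpose_of_trivial, ← star_eq_conjTranspose, Unitary.coe_star_mul_self,
      one_mulVec]
  have hwL : ∀ i, hB.1.eigenvalues i ≤ L := fun i ↦ by
    have := hBL ((U : Matrix ι ι ℝ) *ᵥ Pi.single i 1)
    rw [hquad, hnorm] at this
    simpa [Pi.single_apply, ite_pow] using this
  have hwa : ∑ i, hB.1.eigenvalues i ≤ a := by
    have := hB.1.trace_eq_sum_eigenvalues
    simp only [RCLike.ofReal_real_eq_id, id] at this
    rwa [← this]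
  rw [← pi_gaussianReal_map_orthonormalBasis hB.1.eigenvectorBasis, Measure.map_apply (by fun_prop)
    (measurableSet_le (by fun_prop) (by fun_prop))]
  change (Measure.pi fun _ : ι ↦ gaussianReal 0 1) {x | (√a + √(2 * L * t)) ^ 2
    ≤ ((U : Matrix ι ι ℝ) *ᵥ x) ⬝ᵥ B *ᵥ ((U : Matrix ι ι ℝ) *ᵥ x)} ≤ _
  simp only [hquad]
  exact pi_gaussianReal_weighted_sum_sq_ge_le hB.eigenvalues_nonneg hwL hwa hL ha ht

end GaussianQuadraticForm

section SubSpecNorm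

open Matrix

variable {n p : ℕ} (X : Matrix (Fin n) (Fin p) ℝ) (G : Finset (Fin p))

lemma subSpecNorm_nonneg : 0 ≤ subSpecNorm X G := by
  apply Real.sSup_nonneg
  rintro r ⟨x, -, -, rfl⟩
  exact Real.sqrt_nonneg _

variable {G} in
lemma sum_mulVec_sq_le_of_supported {x : Fin p → ℝ} (hx : ∀ j ∉ G, x j = 0) :
    ∑ i, (X *ᵥ x) i ^ 2 ≤ subSpecNorm X G ^ 2 * ∑ j, x j ^ 2 := by
  have hCS : ∀ y : Fin p → ℝ, ∑ i, (X *ᵥ y) i ^ 2 ≤ (∑ i, ∑ j, X i j ^ 2) * ∑ j, y j ^ 2 := by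
    intro y
    rw [Finset.sum_mul]
    exact Finset.sum_le_sum fun i _ ↦ Finset.sum_mul_sq_le_sq_mul_sq Finset.univ (X i) y
  obtain h0 | hpos := (Finset.sum_nonneg fun j (_ : j ∈ Finset.univ) ↦ sq_nonneg (x j)).eq_or_lt
  · simpa [← h0] using hCS x
  set N := ∑ j, x j ^ 2
  have hbdd : BddAbove {r | ∃ x : Fin p → ℝ, (∀ j ∉ G, x j = 0) ∧ (∑ j, x j ^ 2) ≤ 1 ∧
      r = Real.sqrt (∑ i, X.mulVec x i ^ 2)} := by
    refine ⟨√(∑ i, ∑ j, X i j ^ 2), ?_⟩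
    rintro r ⟨y, -, hy, rfl⟩
    exact Real.sqrt_le_sqrt ((hCS y).trans (mul_le_of_le_one_right (by positivity) hy))
  have hN : √N ^ 2 = N := Real.sq_sqrt hpos.le
  have hle : √(∑ i, (X *ᵥ ((√N)⁻¹ • x)) i ^ 2) ≤ subSpecNorm X G := by
    refine le_csSup hbdd ⟨(√N)⁻¹ • x, fun j hj ↦ by simp [hx j hj], ?_, rfl⟩
    simp only [Pi.smul_apply, smul_eq_mul, mul_pow, ← Finset.mul_sum, inv_pow, hN]
    exact (inv_mul_cancel₀ hpos.ne').le
  rw [Real.sqrt_le_left (subSpecNorm_nonneg X G)] at hle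
  simp only [mulVec_smul, Pi.smul_apply, smul_eq_mul, mul_pow, ← Finset.mul_sum, inv_pow,
    hN] at hle
  rwa [inv_mul_le_iff₀ hpos, mul_comm] at hle

lemma sum_transpose_mulVec_sq_le (ξ : Fin n → ℝ) :
    ∑ j ∈ G, (Xᵀ *ᵥ ξ) j ^ 2 ≤ subSpecNorm X G ^ 2 * ∑ i, ξ i ^ 2 := by
  set y : Fin p → ℝ := fun j ↦ if j ∈ G then (Xᵀ *ᵥ ξ) j else 0
  set Q := ∑ j ∈ G, (Xᵀ *ᵥ ξ) j ^ 2
  have hQ : 0 ≤ Q := by positivity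
  have hy : ∑ j, y j ^ 2 = Q := by simp [y, Q, ite_pow, Finset.sum_ite_mem]
  have hdual : ∑ i, ξ i * (X *ᵥ y) i = Q := by
    change ξ ⬝ᵥ X *ᵥ y = Q
    rw [dotProduct_mulVec, ← mulVec_transpose]
    simp [y, Q, dotProduct, Finset.sum_ite_mem, sq]
  have hCS := Finset.sum_mul_sq_le_sq_mul_sq Finset.univ ξ (X *ᵥ y)
  have hXy := sum_mulVec_sq_le_of_supported X (G := G) (x := y) fun j hj ↦ by simp [y, hj]
  rw [hdual] at hCS
  rw [hy] at hXy
  obtain h0 | hpos := hQ.eq_or_lt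
  · rw [← h0]
    positivity
  have hξ : 0 ≤ ∑ i, ξ i ^ 2 := by positivity
  have := hCS.trans (mul_le_mul_of_nonneg_left hXy hξ)
  refine le_of_mul_le_mul_right ?_ hpos
  linarith

end SubSpecNorm

lemma gaussianVec_eq_map_s11 (n : ℕ) (σ : ℝ) :
    gaussianVec n σ
      = (Measure.pi fun _ : Fin n ↦ gaussianReal 0 1).map (fun x i ↦ σ * x i) := by
  rw [Measure.pi_map_pi (fun _ ↦ by fun_prop), gaussianVec]
  congr 1
  ext1 i
  rw [gaussianReal_map_const_mul, mul_zero, mul_one]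
  rfl

instance isProbabilityMeasure_gaussianVec (n : ℕ) (σ : ℝ) :
    IsProbabilityMeasure (gaussianVec n σ) := by
  rw [gaussianVec_eq_map_s11]
  exact Measure.isProbabilityMeasure_map (Measurable.aemeasurable (by fun_prop))

open Matrix in
lemma gaussianVec_sqrt_sum_transpose_mulVec_sq_gt_le {n p : ℕ} {σ : ℝ} (hσ : 0 < σ)
    (X : Matrix (Fin n) (Fin p) ℝ) (G : Finset (Fin p)) {S a t : ℝ}
    (hS : subSpecNorm X G ≤ S) (hXa : ∑ j ∈ G, ∑ i, X i j ^ 2 ≤ a) (ht : 0 ≤ t) :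
    gaussianVec n σ
        {ξ | σ * (√a + S * √(2 * t)) < √(∑ j ∈ G, (Xᵀ *ᵥ ξ) j ^ 2)}
      ≤ ENNReal.ofReal (Real.exp (-t)) := by
  have hS0 : 0 ≤ S := (subSpecNorm_nonneg X G).trans hS
  have hquad_le : ∀ ξ : Fin n → ℝ, ∑ j ∈ G, (Xᵀ *ᵥ ξ) j ^ 2 ≤ S ^ 2 * ∑ i, ξ i ^ 2 := fun ξ ↦
    (sum_transpose_mulVec_sq_le X G ξ).trans (by gcongr; exact subSpecNorm_nonneg X G)
  set Y : Matrix (Fin n) G ℝ := X.submatrix id Subtype.val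
  have hquad : ∀ x, x ⬝ᵥ (Y * Yᴴ) *ᵥ x = ∑ j ∈ G, (Xᵀ *ᵥ x) j ^ 2 := fun x ↦ by
    rw [← mulVec_mulVec, dotProduct_mulVec, ← mulVec_transpose,
      conjTranspose_eq_transpose_of_trivial, ← Finset.sum_coe_sort G]
    simp only [dotProduct, ← sq]
    rfl
  have htrace : (Y * Yᴴ).trace = ∑ j ∈ G, ∑ i, X i j ^ 2 := by
    rw [trace_mul_comm, ← Finset.sum_coe_sort G]
    simp [trace, Matrix.mul_apply, Y, sq]
  by_cases hpos : 0 < S ∧ 0 < a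
  · obtain ⟨hSpos, ha⟩ := hpos
    rw [gaussianVec_eq_map_s11, Measure.map_apply (by fun_prop)
      (measurableSet_lt (by fun_prop) (by fun_prop))]
    refine (measure_mono fun x hx ↦ ?_).trans
      (pi_gaussianReal_quadForm_ge_le (posSemidef_self_mul_conjTranspose Y) (L := S ^ 2) (a := a)
        (fun x ↦ ?_) (htrace.trans_le hXa) (by positivity) ha ht)
    · simp only [Set.mem_preimage, Set.mem_ofPred_eq, hquad] at hx ⊢
      have hsmul : (fun i ↦ σ * x i) = σ • x := rfl
      have hroot : √(2 * S ^ 2 * t) = S * √(2 * t) := by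
        rw [show 2 * S ^ 2 * t = S ^ 2 * (2 * t) by ring, Real.sqrt_mul (by positivity),
          Real.sqrt_sq hS0]
      rw [hsmul] at hx
      simp only [mulVec_smul, Pi.smul_apply, smul_eq_mul, mul_pow, ← Finset.mul_sum] at hx
      rw [Real.sqrt_mul (sq_nonneg σ), Real.sqrt_sq hσ.le] at hx
      rw [hroot]
      exact (Real.le_sqrt' (by positivity)).1 (lt_of_mul_lt_mul_left hx hσ.le).le
    · rw [hquad]
      simpa [dotProduct, sq] using hquad_le x
  · have hzero : ∀ ξ : Fin n → ℝ, ∑ j ∈ G, (Xᵀ *ᵥ ξ) j ^ 2 ≤ 0 := by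
      intro ξ
      by_cases hSpos : 0 < S
      · have hX : ∑ j ∈ G, ∑ i, X i j ^ 2 ≤ 0 :=
          hXa.trans (not_lt.1 fun ha ↦ hpos ⟨hSpos, ha⟩)
        refine le_trans (Finset.sum_le_sum fun j _ ↦
          Finset.sum_mul_sq_le_sq_mul_sq Finset.univ (fun i ↦ X i j) ξ) ?_
        rw [← Finset.sum_mul]
        exact mul_nonpos_of_nonpos_of_nonneg hX (by positivity)
      · have : S = 0 := le_antisymm (not_lt.1 hSpos) hS0
        simpa [this] using hquad_le ξ
    have hempty : {ξ | σ * (√a + S * √(2 * t)) < √(∑ j ∈ G, (Xᵀ *ᵥ ξ) j ^ 2)} = ∅ := by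
      refine Set.eq_empty_of_forall_notMem fun ξ hξ ↦ ?_
      rw [Set.mem_ofPred_eq, Real.sqrt_eq_zero_of_nonpos (hzero ξ)] at hξ
      exact absurd hξ (not_lt.2 (by positivity))
    rw [hempty, measure_empty]
    exact zero_le

theorem stmt11 (n p M T : ℕ) (hn : 0 < n)
    (G : Fin M → Finset (Fin p))
    (hdisj : ∀ k l : Fin M, k ≠ l → Disjoint (G k) (G l))
    (hcover : Finset.univ.biUnion G = (Finset.univ : Finset (Fin p)))
    (hcard : ∀ k : Fin M, (G k).card = T)
    (σ : ℝ) (hσ : 0 < σ)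
    (X : Matrix (Fin n) (Fin p) ℝ)
    (hdiag : ∀ j : Fin p, (1 / n) * ∑ i, X i j ^ 2 ≤ 1)
    (ψstar : ℝ) (hψ : ψstar = (⨆ k : Fin M, subSpecNorm X (G k)) / Real.sqrt n)
    (lam : ℝ)
    (hlam : 2 * σ / Real.sqrt n *
      (Real.sqrt T + ψstar * Real.sqrt (2 * Real.log (2 * M))) ≤ lam) :
    gaussianVec n σ
        {ξ | ∀ k : Fin M,
          (1 / n) * Real.sqrt (∑ j ∈ G k, X.transpose.mulVec ξ j ^ 2) ≤ lam / 2}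
      ≥ 1/2 := by
  have hn' : (0 : ℝ) < n := by exact_mod_cast hn
  obtain rfl | hM := M.eq_zero_or_pos
  · simp
  have hM' : (1 : ℝ) ≤ M := by exact_mod_cast hM
  set S := ⨆ k : Fin M, subSpecNorm X (G k)
  set t := Real.log (2 * M)
  have ht : 0 ≤ t := Real.log_nonneg (by linarith)
  set bad : Fin M → Set (Fin n → ℝ) := fun k ↦
    {ξ | σ * (√(n * T) + S * √(2 * t)) < √(∑ j ∈ G k, X.transpose.mulVec ξ j ^ 2)}
  have hbad : ∀ k, gaussianVec n σ (bad k) ≤ ENNReal.ofReal (Real.exp (-t)) := by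
    intro k
    refine gaussianVec_sqrt_sum_transpose_mulVec_sq_gt_le hσ X (G k)
      (le_ciSup (f := fun k ↦ subSpecNorm X (G k)) (Set.finite_range _).bddAbove k) ?_ ht
    calc ∑ j ∈ G k, ∑ i, X i j ^ 2 ≤ ∑ j ∈ G k, (n : ℝ) := by
          refine Finset.sum_le_sum fun j _ ↦ ?_
          have := hdiag j
          rwa [one_div, inv_mul_le_iff₀ hn', mul_one] at this
      _ = n * T := by simp [hcard k, mul_comm]
  have hunion : gaussianVec n σ (⋃ k, bad k) ≤ 1 / 2 := by
    calc gaussianVec n σ (⋃ k, bad k) ≤ ∑ k, gaussianVec n σ (bad k) :=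
          measure_iUnion_fintype_le _ _
      _ ≤ ∑ _k : Fin M, ENNReal.ofReal (Real.exp (-t)) := Finset.sum_le_sum fun k _ ↦ hbad k
      _ = ENNReal.ofReal (M * Real.exp (-t)) := by
          simp [ENNReal.ofReal_mul]
      _ = ENNReal.ofReal (1 / 2) := by
          rw [Real.exp_neg, Real.exp_log (by positivity)]
          congr 1
          field_simp
      _ = 1 / 2 := by rw [ENNReal.ofReal_div_of_pos two_pos]; simp
  have hmeas : MeasurableSet (⋃ k, bad k) := MeasurableSet.iUnion fun k ↦
    measurableSet_lt (by fun_prop) (by fun_prop)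
  have hthreshold : σ * (√(n * T) + S * √(2 * t)) ≤ n * (lam / 2) := by
    have hsq : √(n : ℝ) ^ 2 = n := Real.sq_sqrt hn'.le
    have hsn : 0 < √(n : ℝ) := Real.sqrt_pos.2 hn'
    calc σ * (√(n * T) + S * √(2 * t))
        = n * (2 * σ / √n * (√T + ψstar * √(2 * t)) / 2) := by
          rw [hψ, Real.sqrt_mul hn'.le]
          field_simp
          rw [hsq]
          ring
      _ ≤ n * (lam / 2) := by gcongr
  calc (1 / 2 : ℝ≥0∞) = 1 - 1 / 2 := by simp
    _ ≤ 1 - gaussianVec n σ (⋃ k, bad k) := tsub_le_tsub_left hunion 1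
    _ = gaussianVec n σ (⋃ k, bad k)ᶜ := (prob_compl_eq_one_sub hmeas).symm
    _ ≤ _ := by
        refine measure_mono fun ξ hξ k ↦ ?_
        simp only [Set.mem_compl_iff, Set.mem_iUnion, not_exists] at hξ
        have hk : √(∑ j ∈ G k, X.transpose.mulVec ξ j ^ 2) ≤ σ * (√(n * T) + S * √(2 * t)) :=
          not_lt.1 fun h ↦ hξ k h
        rw [one_div, inv_mul_le_iff₀ hn']
        exact hk.trans hthreshold
end
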